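/- For every real ε > 0 there exists a positive integer n₁(ε) such that the following holds: let n, m be integers with n ≥ n₁(ε) and 1 ≤ m ≤ n/3, and let H be a stable 3-graph on the vertex set [n]. If e(H) > f(n,m,3) − ε⁴n³ and ν(H) < m, then H is ε-close to S(n,m,3) or H is ε-close to D(n,m,3). -/

import Mathlib

open Finset

/-- `f(n,m,k) = max{C(n,k) - C(n-m+1,k), C(km-1,k)}`. -/
def fEMC (n m k : ℕ) : ℕ :=
  max (Nat.choose n k - Nat.choose (n - m + 1) k) (Nat.choose (k * m - 1) k)

/-- `F` is a `k`-graph on the vertex set `[n] = {1,…,n}`. -/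
def IsKGraphOn (n k : ℕ) (F : Finset (Finset ℕ)) : Prop :=
  ∀ e ∈ F, e ⊆ Finset.Icc 1 n ∧ e.card = k

/-- The family `F = (F_1,…,F_m)` admits a rainbow matching. -/
def HasRainbowMatching {m : ℕ} (F : Fin m → Finset (Finset ℕ)) : Prop :=
  ∃ e : Fin m → Finset ℕ, (∀ i, e i ∈ F i) ∧
    ∀ i j : Fin m, i ≠ j → Disjoint (e i) (e j)

/-- Degree of a vertex `v` in the hypergraph `F`. -/
def degOf (F : Finset (Finset ℕ)) (v : ℕ) : ℕ := (F.filter (fun e => v ∈ e)).card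

/-- The family `F` of `k`-graphs on `[n]` is saturated. -/
def Saturated (n k : ℕ) {m : ℕ} (F : Fin m → Finset (Finset ℕ)) : Prop :=
  ¬ HasRainbowMatching F ∧
    ∀ (i : Fin m) (e : Finset ℕ), e ⊆ Finset.Icc 1 n → e.card = k → e ∉ F i →
      HasRainbowMatching (Function.update F i (insert e (F i)))

/-- Elementwise domination order: the increasing enumeration of `e` is
pointwise at most that of `f` (this forces `e.card = f.card`). -/
def DomLE (e f : Finset ℕ) : Prop :=
  List.Forall₂ (· ≤ ·) (e.sort (· ≤ ·)) (f.sort (· ≤ ·))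

/-- `F` is a stable hypergraph on vertex set `[n]`. -/
def StableGraph (n : ℕ) (F : Finset (Finset ℕ)) : Prop :=
  ∀ e f : Finset ℕ, e ⊆ Finset.Icc 1 n → DomLE e f → f ∈ F → e ∈ F

/-- `S(n,m,k)`: all `k`-subsets of `[n]` meeting `[m-1]`. -/
def SGraph (n m k : ℕ) : Finset (Finset ℕ) :=
  ((Finset.Icc 1 n).powersetCard k).filter (fun e => (e ∩ Finset.Icc 1 (m - 1)).Nonempty)

/-- `D(n,m,k)`: all `k`-subsets of `[km-1]`. -/
def DGraph (n m k : ℕ) : Finset (Finset ℕ) :=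
  (Finset.Icc 1 (k * m - 1)).powersetCard k

/-- `H(F)`: the `(k+1)`-graph on `[n] ∪ {v_1,…,v_m}`, where `v_i` is encoded
as the natural number `n + i`, with edges `e ∪ {v_i}` for `e ∈ F_i`. -/
def HF (n : ℕ) {m : ℕ} (F : Fin m → Finset (Finset ℕ)) : Finset (Finset ℕ) :=
  Finset.univ.biUnion (fun i : Fin m => (F i).image (fun e => insert (n + i.1 + 1) e))

/-- `H_S(n,m,k) = H(F)` with every `F_i = S(n,m,k)`. -/
def HS (n m k : ℕ) : Finset (Finset ℕ) := HF n (fun _ : Fin m => SGraph n m k)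

/-- `H_D(n,m,k) = H(F)` with every `F_i = D(n,m,k)`. -/
def HD (n m k : ℕ) : Finset (Finset ℕ) := HF n (fun _ : Fin m => DGraph n m k)

/-- `H*(F)`: `H(F)` together with the edges `e ∪ {u_j}`, `e` a `k`-subset of `[n]`,
`j ∈ [r]`, `r = ⌊n/k⌋ - m`, where `u_j` is encoded as the natural number `n + m + j`. -/
def HstarF (n k : ℕ) {m : ℕ} (F : Fin m → Finset (Finset ℕ)) : Finset (Finset ℕ) :=
  HF n F ∪ Finset.univ.biUnion (fun j : Fin (n / k - m) =>
    ((Finset.Icc 1 n).powersetCard k).image (fun e => insert (n + m + j.1 + 1) e))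

/-- A set of edges is a matching if its edges are pairwise disjoint. -/
def IsMatching (M : Finset (Finset ℕ)) : Prop :=
  ∀ e ∈ M, ∀ f ∈ M, e ≠ f → Disjoint e f

/-- `H₂` is `ε`-close to `H₁` (as `u`-graphs on a vertex set of size `N`):
`|E(H₁) \ E(H₂)| ≤ ε · N^u`. -/
def IsEpsClose (ε : ℝ) (N u : ℕ) (H₁ H₂ : Finset (Finset ℕ)) : Prop :=
  (((H₁ \ H₂).card : ℝ)) ≤ ε * (N : ℝ) ^ u


/-! ### Stability helpers -/

lemma sl_sort3 {x y z : ℕ} (h1 : x < y) (h2 : y < z) :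
    (({x, y, z} : Finset ℕ)).sort (· ≤ ·) = [x, y, z] := by
  rw [Finset.sort_insert, Finset.sort_insert, Finset.sort_singleton]
  · intro b hb; simp at hb; omega
  · simp; omega
  · intro b hb; simp at hb; omega
  · simp; omega

lemma sl_stab_sorted {n : ℕ} {H : Finset (Finset ℕ)} (hK : IsKGraphOn n 3 H) (hS : StableGraph n H)
    {x y z x' y' z' : ℕ} (h1 : x < y) (h2 : y < z) (h1' : x' < y') (h2' : y' < z')
    (hx : x' ≤ x) (hy : y' ≤ y) (hz : z' ≤ z) (h0 : 1 ≤ x') (he : ({x, y, z} : Finset ℕ) ∈ H) :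
    ({x', y', z'} : Finset ℕ) ∈ H := by
  refine hS _ _ ?_ ?_ he
  · have := (hK _ he).1
    have hzn : z ∈ Finset.Icc 1 n := this (by simp)
    simp at hzn
    intro w hw
    simp at hw ⊢
    omega
  · unfold DomLE
    rw [sl_sort3 h1 h2, sl_sort3 h1' h2']
    simp [hx, hy, hz]

lemma sl_perm1 (a b c : ℕ) : ({a, b, c} : Finset ℕ) = {b, a, c} := by
  ext w; simp; tauto
lemma sl_perm2 (a b c : ℕ) : ({a, b, c} : Finset ℕ) = {a, c, b} := by
  ext w; simp; tauto

lemma sl_stab_half {n : ℕ} {H : Finset (Finset ℕ)} (hK : IsKGraphOn n 3 H) (hS : StableGraph n H)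
    {x y z a b c : ℕ} (h1 : x < y) (h2 : y < z) (hab : a ≠ b) (hac : a ≠ c) (hbc : b ≠ c)
    (hx : a ≤ x) (hy : b ≤ y) (hz : c ≤ z) (ha : 1 ≤ a) (hb : 1 ≤ b) (hc : 1 ≤ c)
    (he : ({x, y, z} : Finset ℕ) ∈ H) :
    ({a, b, c} : Finset ℕ) ∈ H := by
  have key : ∀ x' y' z' : ℕ, x' < y' → y' < z' → x' ≤ x → y' ≤ y → z' ≤ z → 1 ≤ x' →
      ({x', y', z'} : Finset ℕ) ∈ H := fun x' y' z' p q r s t u =>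
    sl_stab_sorted hK hS h1 h2 p q r s t u he
  rcases lt_or_gt_of_ne hab with h | h <;> rcases lt_or_gt_of_ne hac with h' | h' <;>
    rcases lt_or_gt_of_ne hbc with h'' | h''
  · exact key a b c h h'' hx hy hz ha
  · rw [sl_perm2]; exact key a c b h' h'' hx (by omega) (by omega) ha
  · omega
  · rw [sl_perm2, sl_perm1]; exact key c a b h' h (by omega) (by omega) (by omega) hc
  · rw [sl_perm1]; exact key b a c h h' (by omega) (by omega) (by omega) hb
  · omega
  · rw [sl_perm1, sl_perm2]; exact key b c a h'' h' (by omega) (by omega) (by omega) hb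
  · rw [sl_perm1, sl_perm2, sl_perm1]; exact key c b a h'' h (by omega) (by omega) (by omega) hc

lemma sl_stab {n : ℕ} {H : Finset (Finset ℕ)} (hK : IsKGraphOn n 3 H) (hS : StableGraph n H)
    {x y z a b c : ℕ} (hxy : x ≠ y) (hxz : x ≠ z) (hyz : y ≠ z)
    (hab : a ≠ b) (hac : a ≠ c) (hbc : b ≠ c)
    (hx : a ≤ x) (hy : b ≤ y) (hz : c ≤ z) (ha : 1 ≤ a) (hb : 1 ≤ b) (hc : 1 ≤ c)
    (he : ({x, y, z} : Finset ℕ) ∈ H) :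
    ({a, b, c} : Finset ℕ) ∈ H := by
  rcases lt_or_gt_of_ne hxy with h | h <;> rcases lt_or_gt_of_ne hxz with h' | h' <;>
    rcases lt_or_gt_of_ne hyz with h'' | h''
  · exact sl_stab_half hK hS h h'' hab hac hbc hx hy hz ha hb hc he
  · rw [sl_perm2] at he ⊢
    exact sl_stab_half hK hS h' h'' hac hab hbc.symm hx hz hy ha hc hb he
  · omega
  · rw [sl_perm2, sl_perm1] at he ⊢
    exact sl_stab_half hK hS h' h hac.symm hbc.symm hab hz hx hy hc ha hb he
  · rw [sl_perm1] at he ⊢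
    exact sl_stab_half hK hS h h' hab.symm hbc hac hy hx hz hb ha hc he
  · omega
  · rw [sl_perm1, sl_perm2] at he ⊢
    exact sl_stab_half hK hS h'' h' hbc hab.symm hac.symm hy hz hx hb hc ha he
  · rw [sl_perm1, sl_perm2, sl_perm1] at he ⊢
    exact sl_stab_half hK hS h'' h hbc.symm hac.symm hab.symm hz hy hx hc hb ha he

lemma sl_sort_image (φ : ℕ → ℕ) (e : Finset ℕ) (hφ : StrictMonoOn φ e) :
    (e.image φ).sort (· ≤ ·) = (e.sort (· ≤ ·)).map φ := by
  have hinj : Set.InjOn φ e := hφ.injOn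
  refine (List.Perm.eq_of_pairwise (le := (· ≤ ·)) ?_ (Finset.pairwise_sort _ _) ?_ ?_)
  · intro a b _ _ h1 h2; exact le_antisymm h1 h2
  · rw [List.pairwise_map]
    refine List.Pairwise.imp_of_mem ?_ (Finset.pairwise_sort e (· ≤ ·))
    intro a b ha hb hab
    exact hφ.monotoneOn (by simpa using ha) (by simpa using hb) hab
  · apply (List.perm_ext_iff_of_nodup (Finset.sort_nodup _ _) ?_).2
    · intro a; simp
    · refine List.Nodup.map_on ?_ (Finset.sort_nodup _ _)
      intro x hx y hy h
      exact hinj (by simpa using hx) (by simpa using hy) h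

lemma sl_dom_image (φ : ℕ → ℕ) (e : Finset ℕ) (hφ : StrictMonoOn φ e) (hle : ∀ x ∈ e, φ x ≤ x) :
    DomLE (e.image φ) e := by
  unfold DomLE
  rw [sl_sort_image φ e hφ, List.forall₂_map_left_iff, List.forall₂_same]
  intro x hx
  exact hle x (by simpa using hx)

/-- Moving a vertex set down does not decrease the number of edges inside. -/
lemma sl_compress {n : ℕ} {H : Finset (Finset ℕ)} (hS : StableGraph n H)
    (A B : Finset ℕ) (hA : A ⊆ Finset.Icc 1 n) (N : ℕ) (hAc : A.card = N) (hBc : B.card = N)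
    (hle : ∀ i : Fin N, A.orderEmbOfFin hAc i ≤ B.orderEmbOfFin hBc i) :
    (H.filter (fun e => e ⊆ B)).card ≤ (H.filter (fun e => e ⊆ A)).card := by
  classical
  let ψ : ℕ → ℕ := fun x => if hx : x ∈ B then A.orderEmbOfFin hAc ((B.orderIsoOfFin hBc).symm ⟨x, hx⟩) else x
  have hψA : ∀ x ∈ B, ψ x ∈ A := by
    intro x hx; simp only [ψ, hx, dif_pos]; exact Finset.orderEmbOfFin_mem _ _ _
  have hmono : StrictMonoOn ψ B := by
    intro x hx y hy hxy
    have hx' : x ∈ B := hx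
    have hy' : y ∈ B := hy
    simp only [ψ, hx', hy', dif_pos]
    rw [OrderEmbedding.lt_iff_lt, OrderIso.lt_iff_lt]
    exact hxy
  have hψle : ∀ x ∈ B, ψ x ≤ x := by
    intro x hx
    simp only [ψ, hx, dif_pos]
    refine (hle _).trans ?_
    rw [← Finset.coe_orderIsoOfFin_apply]
    simp
  refine Finset.card_le_card_of_injOn (fun e => e.image ψ) ?_ ?_
  · intro e he
    simp only [Finset.coe_filter, Set.mem_setOf_eq] at he ⊢
    have hsub : e.image ψ ⊆ A := by
      intro y hy
      obtain ⟨x, hx, rfl⟩ := Finset.mem_image.1 hy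
      exact hψA x (he.2 hx)
    refine ⟨hS _ e (hsub.trans hA) (sl_dom_image ψ e (hmono.mono he.2) (fun x hx => hψle x (he.2 hx))) he.1, hsub⟩
  · intro e he f hf hef
    simp only [Finset.coe_filter, Set.mem_setOf_eq] at he hf
    exact Finset.image_injOn_powerset_of_injOn (s := B) hmono.injOn |>.eq_iff
      (by simpa using he.2) (by simpa using hf.2) |>.1 hef


/-! ### The local (finite) analysis of a triple of matching edges -/

lemma sl_forall3 (p : Fin 3 → Prop) : (∀ x, p x) ↔ p 0 ∧ p 1 ∧ p 2 := by
  constructor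
  · intro h; exact ⟨h 0, h 1, h 2⟩
  · rintro ⟨h0, h1, h2⟩ x; fin_cases x <;> assumption

structure SLLoc (EE : Finset (Fin 3 × Fin 3) → Prop) : Prop where
  medge : ∀ b, EE {(b, 0), (b, 1), (b, 2)}
  mono2 : ∀ b c, b ≠ c → ∀ x x' y, x' ≤ x → EE {(b, x), (c, y)} → EE {(b, x'), (c, y)}
  nb : ∀ s1 s2 s3, EE s1 → EE s2 → EE s3 → Disjoint s1 s2 → Disjoint s1 s3 → Disjoint s2 s3 →
    ∀ b : Fin 3, (b, (0 : Fin 3)) ∉ s1 → (b, (0 : Fin 3)) ∉ s2 → (b, (0 : Fin 3)) ∉ s3 → False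

open Classical in
noncomputable def slInd (EE : Finset (Fin 3 × Fin 3) → Prop) (s : Finset (Fin 3 × Fin 3)) : ℕ :=
  if EE s then 1 else 0

lemma slInd_le (EE : Finset (Fin 3 × Fin 3) → Prop) (s) : slInd EE s ≤ 1 := by
  unfold slInd; split_ifs <;> omega

lemma slInd_pos {EE : Finset (Fin 3 × Fin 3) → Prop} {s} (h : 1 ≤ slInd EE s) : EE s := by
  unfold slInd at h; split_ifs at h with h1
  · exact h1
  · omega

lemma slInd_zero {EE : Finset (Fin 3 × Fin 3) → Prop} {s} (h : ¬ EE s) : slInd EE s = 0 := by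
  unfold slInd; rw [if_neg h]

lemma sl_pair {EE : Finset (Fin 3 × Fin 3) → Prop} (h : SLLoc EE) {s1 s2 s3} (h1 : EE s1)
    (d12 : Disjoint s1 s2) (d13 : Disjoint s1 s3) (d23 : Disjoint s2 s3) (b : Fin 3)
    (n1 : (b, (0 : Fin 3)) ∉ s1) (n2 : (b, (0 : Fin 3)) ∉ s2) (n3 : (b, (0 : Fin 3)) ∉ s3) :
    slInd EE s2 + slInd EE s3 ≤ 1 := by
  by_contra hc
  have a2 := slInd_le EE s2
  have a3 := slInd_le EE s3
  exact h.nb s1 s2 s3 h1 (slInd_pos (by omega)) (slInd_pos (by omega)) d12 d13 d23 b n1 n2 n3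

lemma sl_single {EE : Finset (Fin 3 × Fin 3) → Prop} (h : SLLoc EE) {s1 s2 s3} (h1 : EE s1)
    (h2 : EE s2)
    (d12 : Disjoint s1 s2) (d13 : Disjoint s1 s3) (d23 : Disjoint s2 s3) (b : Fin 3)
    (n1 : (b, (0 : Fin 3)) ∉ s1) (n2 : (b, (0 : Fin 3)) ∉ s2) (n3 : (b, (0 : Fin 3)) ∉ s3) :
    slInd EE s3 = 0 := 
  slInd_zero (fun h3 => h.nb s1 s2 s3 h1 h2 h3 d12 d13 d23 b n1 n2 n3)

noncomputable def slT (EE : Finset (Fin 3 × Fin 3) → Prop) (b c d : Fin 3) : ℕ :=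
  ∑ x, ∑ y, ∑ z, slInd EE {(b, x), (c, y), (d, z)}

noncomputable def slP (EE : Finset (Fin 3 × Fin 3) → Prop) (b c : Fin 3) : ℕ :=
  ∑ x, ∑ y, slInd EE {(b, x), (c, y)}

lemma sl_bound (f : Fin 3 → Fin 3 → Fin 3 → ℕ) (hf : ∀ x y z, f x y z ≤ 1) :
    ∑ x, ∑ y, ∑ z, f x y z ≤ 27 := by
  simp only [sl_forall3] at hf
  simp only [Fin.sum_univ_three]
  omega

section
variable {EE : Finset (Fin 3 × Fin 3) → Prop} (h : SLLoc EE) {b c d : Fin 3}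

-- each use: disjointness goals are closed by simp
lemma sl_T23 (h : SLLoc EE) (hbc : b ≠ c) (hbd : b ≠ d) (hcd : c ≠ d) (hp : EE {(b, 0), (c, 0)}) :
    slT EE b c d ≤ 23 := by
  have hf : ∀ x y z, slInd EE {(b, x), (c, y), (d, z)} ≤ 1 := fun x y z => slInd_le _ _
  have P : ∀ y z y' z' : Fin 3, y ≠ y' → z ≠ z' → y ≠ 0 → y' ≠ 0 → z ≠ 0 → z' ≠ 0 →
      slInd EE {(b, 1), (c, y), (d, z)} + slInd EE {(b, 2), (c, y'), (d, z')} ≤ 1 := by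
    intro y z y' z' h1 h2 h3 h4 h5 h6
    refine sl_pair h hp ?_ ?_ ?_ d ?_ ?_ ?_ <;>
      simp [hbc, hbd, hcd, hbc.symm, hbd.symm, hcd.symm, h1, h2, h3, h4, h5, h6,
        h1.symm, h2.symm, h3.symm, h4.symm, h5.symm, h6.symm]
  have p1 := P 1 1 2 2 (by decide) (by decide) (by decide) (by decide) (by decide) (by decide)
  have p2 := P 1 2 2 1 (by decide) (by decide) (by decide) (by decide) (by decide) (by decide)
  have p3 := P 2 1 1 2 (by decide) (by decide) (by decide) (by decide) (by decide) (by decide)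
  have p4 := P 2 2 1 1 (by decide) (by decide) (by decide) (by decide) (by decide) (by decide)
  simp only [sl_forall3] at hf
  simp only [slT, Fin.sum_univ_three]
  omega

/-- `300` gives at most 21 triples. -/
lemma sl_T21row (h : SLLoc EE) (hbc : b ≠ c) (hbd : b ≠ d) (hcd : c ≠ d)
    (hp : ∀ y, EE {(b, 0), (c, y)}) :
    slT EE b c d ≤ 21 := by
  have hf : ∀ x y z, slInd EE {(b, x), (c, y), (d, z)} ≤ 1 := fun x y z => slInd_le _ _
  have P : ∀ w y z y' z' : Fin 3, w ≠ y → w ≠ y' → y ≠ y' → z ≠ z' → z ≠ 0 → z' ≠ 0 →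
      slInd EE {(b, 1), (c, y), (d, z)} + slInd EE {(b, 2), (c, y'), (d, z')} ≤ 1 := by
    intro w y z y' z' h1 h2 h3 h4 h5 h6
    refine sl_pair h (hp w) ?_ ?_ ?_ d ?_ ?_ ?_ <;>
      simp [hbc, hbd, hcd, hbc.symm, hbd.symm, hcd.symm, h1, h2, h3, h4, h5, h6,
        h1.symm, h2.symm, h3.symm, h4.symm, h5.symm, h6.symm]
  have p1 := P 2 0 1 1 2 (by decide) (by decide) (by decide) (by decide) (by decide) (by decide)
  have p2 := P 2 0 2 1 1 (by decide) (by decide) (by decide) (by decide) (by decide) (by decide)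
  have p3 := P 0 1 1 2 2 (by decide) (by decide) (by decide) (by decide) (by decide) (by decide)
  have p4 := P 0 1 2 2 1 (by decide) (by decide) (by decide) (by decide) (by decide) (by decide)
  have p5 := P 1 2 1 0 2 (by decide) (by decide) (by decide) (by decide) (by decide) (by decide)
  have p6 := P 1 2 2 0 1 (by decide) (by decide) (by decide) (by decide) (by decide) (by decide)
  simp only [sl_forall3] at hf
  simp only [slT, Fin.sum_univ_three]
  omega

/-- The consequences of the shape `210` that we use. -/
lemma sl_210 (h : SLLoc EE) (hbc : b ≠ c) (hbd : b ≠ d) (hcd : c ≠ d)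
    (h01 : EE {(b, 0), (c, 1)}) (h10 : EE {(b, 1), (c, 0)}) :
    slInd EE {(b, 2), (c, 2), (d, 1)} = 0 ∧ slInd EE {(b, 2), (c, 2), (d, 2)} = 0 ∧
    slInd EE {(b, 1), (c, 2), (d, 1)} + slInd EE {(b, 2), (c, 0), (d, 2)} ≤ 1 ∧
    slInd EE {(b, 1), (c, 2), (d, 2)} + slInd EE {(b, 2), (c, 0), (d, 1)} ≤ 1 ∧
    slInd EE {(b, 2), (c, 1), (d, 1)} + slInd EE {(b, 0), (c, 2), (d, 2)} ≤ 1 ∧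
    slInd EE {(b, 2), (c, 1), (d, 2)} + slInd EE {(b, 0), (c, 2), (d, 1)} ≤ 1 := by
  refine ⟨?_, ?_, ?_, ?_, ?_, ?_⟩
  · refine sl_single h h01 h10 ?_ ?_ ?_ d ?_ ?_ ?_ <;>
      simp [hbc, hbd, hcd, hbc.symm, hbd.symm, hcd.symm]
  · refine sl_single h h01 h10 ?_ ?_ ?_ d ?_ ?_ ?_ <;>
      simp [hbc, hbd, hcd, hbc.symm, hbd.symm, hcd.symm]
  · refine sl_pair h h01 ?_ ?_ ?_ d ?_ ?_ ?_ <;>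
      simp [hbc, hbd, hcd, hbc.symm, hbd.symm, hcd.symm]
  · refine sl_pair h h01 ?_ ?_ ?_ d ?_ ?_ ?_ <;>
      simp [hbc, hbd, hcd, hbc.symm, hbd.symm, hcd.symm]
  · refine sl_pair h h10 ?_ ?_ ?_ d ?_ ?_ ?_ <;>
      simp [hbc, hbd, hcd, hbc.symm, hbd.symm, hcd.symm]
  · refine sl_pair h h10 ?_ ?_ ?_ d ?_ ?_ ?_ <;>
      simp [hbc, hbd, hcd, hbc.symm, hbd.symm, hcd.symm]

lemma sl_T21 (h : SLLoc EE) (hbc : b ≠ c) (hbd : b ≠ d) (hcd : c ≠ d)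
    (h01 : EE {(b, 0), (c, 1)}) (h10 : EE {(b, 1), (c, 0)}) :
    slT EE b c d ≤ 21 := by
  have hf : ∀ x y z, slInd EE {(b, x), (c, y), (d, z)} ≤ 1 := fun x y z => slInd_le _ _
  obtain ⟨a1, a2, a3, a4, a5, a6⟩ := sl_210 h hbc hbd hcd h01 h10
  simp only [sl_forall3] at hf
  simp only [slT, Fin.sum_univ_three]
  omega

lemma sl_swap (b c d : Fin 3) (x y z : Fin 3) :
    ({(b, x), (c, y), (d, z)} : Finset (Fin 3 × Fin 3)) = {(b, x), (d, z), (c, y)} := by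
  ext w; simp only [Finset.mem_insert, Finset.mem_singleton]; tauto

lemma sl_swap' (b c d : Fin 3) (x y z : Fin 3) :
    ({(b, x), (c, y), (d, z)} : Finset (Fin 3 × Fin 3)) = {(c, y), (b, x), (d, z)} := by
  ext w; simp only [Finset.mem_insert, Finset.mem_singleton]; tauto

lemma sl_swap2 (b c : Fin 3) (x y : Fin 3) :
    ({(b, x), (c, y)} : Finset (Fin 3 × Fin 3)) = {(c, y), (b, x)} := Finset.pair_comm _ _

lemma sl_T20 (h : SLLoc EE) (hbc : b ≠ c) (hbd : b ≠ d) (hcd : c ≠ d)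
    (h01 : EE {(b, 0), (c, 1)}) (h10 : EE {(b, 1), (c, 0)})
    (k01 : EE {(b, 0), (d, 1)}) (k10 : EE {(b, 1), (d, 0)}) :
    slT EE b c d ≤ 20 := by
  have hf : ∀ x y z, slInd EE {(b, x), (c, y), (d, z)} ≤ 1 := fun x y z => slInd_le _ _
  obtain ⟨a1, a2, a3, a4, a5, a6⟩ := sl_210 h hbc hbd hcd h01 h10
  obtain ⟨b1, b2, b3, b4, b5, b6⟩ := sl_210 h hbd hbc hcd.symm k01 k10
  simp only [sl_swap b d c] at b1 b2 b3 b4 b5 b6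
  simp only [sl_forall3] at hf
  simp only [slT, Fin.sum_univ_three]
  omega

lemma sl_T19 (h : SLLoc EE) (hbc : b ≠ c) (hbd : b ≠ d) (hcd : c ≠ d)
    (h01 : ∀ y, EE {(b, 0), (c, y)}) (h10 : ∀ y, EE {(b, y), (c, 0)}) :
    slT EE b c d ≤ 19 := by
  have hf : ∀ x y z, slInd EE {(b, x), (c, y), (d, z)} ≤ 1 := fun x y z => slInd_le _ _
  have S : ∀ x' y' x y z : Fin 3, x ≠ 0 → y ≠ 0 → z ≠ 0 → x' ≠ x → y' ≠ y → x' ≠ 0 → y' ≠ 0 →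
      slInd EE {(b, x), (c, y), (d, z)} = 0 := by
    intro x' y' x y z h1 h2 h3 h4 h5 h6 h7
    refine sl_single h (h01 y') (h10 x') ?_ ?_ ?_ d ?_ ?_ ?_ <;>
      simp [hbc, hbd, hcd, hbc.symm, hbd.symm, hcd.symm, h1, h2, h3, h4, h5, h6, h7,
        h1.symm, h2.symm, h3.symm, h4.symm, h5.symm, h6.symm, h7.symm]
  have p1 := S 2 2 1 1 1 (by decide) (by decide) (by decide) (by decide) (by decide) (by decide) (by decide)
  have p2 := S 2 2 1 1 2 (by decide) (by decide) (by decide) (by decide) (by decide) (by decide) (by decide)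
  have p3 := S 2 1 1 2 1 (by decide) (by decide) (by decide) (by decide) (by decide) (by decide) (by decide)
  have p4 := S 2 1 1 2 2 (by decide) (by decide) (by decide) (by decide) (by decide) (by decide) (by decide)
  have p5 := S 1 2 2 1 1 (by decide) (by decide) (by decide) (by decide) (by decide) (by decide) (by decide)
  have p6 := S 1 2 2 1 2 (by decide) (by decide) (by decide) (by decide) (by decide) (by decide) (by decide)
  have p7 := S 1 1 2 2 1 (by decide) (by decide) (by decide) (by decide) (by decide) (by decide) (by decide)
  have p8 := S 1 1 2 2 2 (by decide) (by decide) (by decide) (by decide) (by decide) (by decide) (by decide)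
  simp only [sl_forall3] at hf
  simp only [slT, Fin.sum_univ_three]
  omega

lemma sl_TQ (h : SLLoc EE) (hbc : b ≠ c) (hbd : b ≠ d) (hcd : c ≠ d) (hq : EE {(b, 0)}) :
    slT EE b c d ≤ 19 := by
  have hf : ∀ x y z, slInd EE {(b, x), (c, y), (d, z)} ≤ 1 := fun x y z => slInd_le _ _
  have P : ∀ y z y' z' : Fin 3, y ≠ y' → z ≠ z' → z ≠ 0 → z' ≠ 0 →
      slInd EE {(b, 1), (c, y), (d, z)} + slInd EE {(b, 2), (c, y'), (d, z')} ≤ 1 := by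
    intro y z y' z' h1 h2 h5 h6
    refine sl_pair h hq ?_ ?_ ?_ d ?_ ?_ ?_ <;>
      simp [hbc, hbd, hcd, hbc.symm, hbd.symm, hcd.symm, h1, h2, h5, h6,
        h1.symm, h2.symm, h5.symm, h6.symm]
  have P' : ∀ y z y' z' : Fin 3, y ≠ y' → z ≠ z' → y ≠ 0 → y' ≠ 0 →
      slInd EE {(b, 1), (c, y), (d, z)} + slInd EE {(b, 2), (c, y'), (d, z')} ≤ 1 := by
    intro y z y' z' h1 h2 h5 h6
    refine sl_pair h hq ?_ ?_ ?_ c ?_ ?_ ?_ <;>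
      simp [hbc, hbd, hcd, hbc.symm, hbd.symm, hcd.symm, h1, h2, h5, h6,
        h1.symm, h2.symm, h5.symm, h6.symm]
  have p1 := P' 1 0 2 1 (by decide) (by decide) (by decide) (by decide)
  have p2 := P' 2 0 1 2 (by decide) (by decide) (by decide) (by decide)
  have p3 := P 0 1 2 2 (by decide) (by decide) (by decide) (by decide)
  have p4 := P 0 2 1 1 (by decide) (by decide) (by decide) (by decide)
  have p5 := P' 1 1 2 0 (by decide) (by decide) (by decide) (by decide)
  have p6 := P 1 2 0 1 (by decide) (by decide) (by decide) (by decide)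
  have p7 := P 2 1 0 2 (by decide) (by decide) (by decide) (by decide)
  have p8 := P' 2 2 1 0 (by decide) (by decide) (by decide) (by decide)
  simp only [sl_forall3] at hf
  simp only [slT, Fin.sum_univ_three]
  omega

/-- Shape analysis of a pair. -/
lemma sl_shape (h : SLLoc EE) (hbc : b ≠ c) (hbd : b ≠ d) (hcd : c ≠ d) :
    slP EE b c ≤ 5 ∧ (1 ≤ slP EE b c → EE {(b, 0), (c, 0)}) ∧
    (3 ≤ slP EE b c → (∀ y, EE {(b, 0), (c, y)}) ∨ (∀ x, EE {(b, x), (c, 0)}) ∨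
      (EE {(b, 0), (c, 1)} ∧ EE {(b, 1), (c, 0)})) ∧
    (4 ≤ slP EE b c → (EE {(b, 0), (c, 1)} ∧ EE {(b, 1), (c, 0)})) ∧
    (5 ≤ slP EE b c → (∀ y, EE {(b, 0), (c, y)}) ∧ (∀ x, EE {(b, x), (c, 0)})) := by
  have hf : ∀ x y, slInd EE {(b, x), (c, y)} ≤ 1 := fun x y => slInd_le _ _
  have hone : ∀ s, EE s → slInd EE s = 1 := by
    intro s hs; unfold slInd; rw [if_pos hs]
  have m1 : ∀ x x' y, x' ≤ x → slInd EE {(b, x), (c, y)} ≤ slInd EE {(b, x'), (c, y)} := by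
    intro x x' y hx
    by_cases hE : EE {(b, x), (c, y)}
    · rw [hone _ hE, hone _ (h.mono2 b c hbc x x' y hx hE)]
    · rw [slInd_zero hE]; omega
  have m2 : ∀ x y y', y' ≤ y → slInd EE {(b, x), (c, y)} ≤ slInd EE {(b, x), (c, y')} := by
    intro x y y' hx
    by_cases hE : EE {(b, x), (c, y)}
    · rw [hone _ hE]
      rw [sl_swap2] at hE
      have := h.mono2 c b hbc.symm y y' x hx hE
      rw [sl_swap2] at this
      rw [hone _ this]
    · rw [slInd_zero hE]; omega
  have a1 : slInd EE {(b, 1), (c, 1)} + slInd EE {(b, 0), (c, 2)} ≤ 1 := by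
    refine sl_pair h (h.medge d) ?_ ?_ ?_ c ?_ ?_ ?_ <;>
      simp [hbc, hbd, hcd, hbc.symm, hbd.symm, hcd.symm]
  have a2 : slInd EE {(b, 1), (c, 1)} + slInd EE {(b, 2), (c, 0)} ≤ 1 := by
    refine sl_pair h (h.medge d) ?_ ?_ ?_ b ?_ ?_ ?_ <;>
      simp [hbc, hbd, hcd, hbc.symm, hbd.symm, hcd.symm]
  have e01 := m1 1 0 0 (by decide)
  have e02 := m1 2 1 0 (by decide)
  have e11 := m1 1 0 1 (by decide)
  have e12 := m1 2 1 1 (by decide)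
  have e21 := m1 1 0 2 (by decide)
  have e22 := m1 2 1 2 (by decide)
  have g01 := m2 0 1 0 (by decide)
  have g02 := m2 0 2 1 (by decide)
  have g11 := m2 1 1 0 (by decide)
  have g12 := m2 1 2 1 (by decide)
  have g21 := m2 2 1 0 (by decide)
  have g22 := m2 2 2 1 (by decide)
  simp only [sl_forall3] at hf ⊢
  simp only [slP, Fin.sum_univ_three]
  refine ⟨by omega, fun hh => slInd_pos (by omega), fun hh => ?_, fun hh => ⟨slInd_pos (by omega), slInd_pos (by omega)⟩, fun hh => ⟨⟨slInd_pos (by omega), slInd_pos (by omega), slInd_pos (by omega)⟩, slInd_pos (by omega), slInd_pos (by omega), slInd_pos (by omega)⟩⟩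
  by_cases h1 : 1 ≤ slInd EE {(b, 0), (c, 2)}
  · left; exact ⟨slInd_pos (by omega), slInd_pos (by omega), slInd_pos (by omega)⟩
  by_cases h2 : 1 ≤ slInd EE {(b, 2), (c, 0)}
  · right; left; exact ⟨slInd_pos (by omega), slInd_pos (by omega), slInd_pos (by omega)⟩
  right; right; exact ⟨slInd_pos (by omega), slInd_pos (by omega)⟩

lemma slT_swap (b c d : Fin 3) : slT EE b c d = slT EE b d c := by
  unfold slT
  refine Finset.sum_congr rfl (fun x _ => ?_)
  rw [Finset.sum_comm]
  simp only [sl_swap b c d]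

lemma slT_swap' (b c d : Fin 3) : slT EE b c d = slT EE c b d := by
  unfold slT
  rw [Finset.sum_comm]
  simp only [sl_swap' b c d]

lemma slP_swap (b c : Fin 3) : slP EE b c = slP EE c b := by
  unfold slP
  rw [Finset.sum_comm]
  simp only [sl_swap2 b c]

/-- `T` bounds from one pair. -/
lemma sl_pairT (h : SLLoc EE) (hbc : b ≠ c) (hbd : b ≠ d) (hcd : c ≠ d) :
    slP EE b c ≤ 5 ∧ (1 ≤ slP EE b c → slT EE b c d ≤ 23) ∧
    (3 ≤ slP EE b c → slT EE b c d ≤ 21) ∧ (5 ≤ slP EE b c → slT EE b c d ≤ 19) := by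
  obtain ⟨s1, s2, s3, s4, s5⟩ := sl_shape h hbc hbd hcd
  refine ⟨s1, fun hh => sl_T23 h hbc hbd hcd (s2 hh), fun hh => ?_, fun hh => ?_⟩
  · rcases s3 hh with hh | hh | hh
    · exact sl_T21row h hbc hbd hcd hh
    · rw [slT_swap']
      refine sl_T21row h hbc.symm hcd hbd (fun y => ?_)
      rw [sl_swap2]; exact hh y
    · exact sl_T21 h hbc hbd hcd hh.1 hh.2
  · exact sl_T19 h hbc hbd hcd (s5 hh).1 (s5 hh).2

/-- Main local lemma. -/
lemma sl_local (h : SLLoc EE) :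
    slP EE 0 1 ≤ 5 ∧ slP EE 0 2 ≤ 5 ∧ slP EE 1 2 ≤ 5 ∧ slT EE 0 1 2 ≤ 27 ∧
    (1 ≤ slP EE 0 1 + slP EE 0 2 + slP EE 1 2 →
      2 * slT EE 0 1 2 + (slP EE 0 1 + slP EE 0 2 + slP EE 1 2) ≤ 53) ∧
    (∀ b, EE {(b, 0)} → slT EE 0 1 2 ≤ 19) := by
  obtain ⟨a1, a2, a3, a4⟩ := sl_pairT h (b := 0) (c := 1) (d := 2) (by decide) (by decide) (by decide)
  obtain ⟨b1, b2, b3, b4⟩ := sl_pairT h (b := 0) (c := 2) (d := 1) (by decide) (by decide) (by decide)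
  obtain ⟨c1, c2, c3, c4⟩ := sl_pairT h (b := 1) (c := 2) (d := 0) (by decide) (by decide) (by decide)
  have e1 : slT EE 0 2 1 = slT EE 0 1 2 := slT_swap _ _ _
  have e2 : slT EE 1 2 0 = slT EE 0 1 2 := by rw [slT_swap, slT_swap']
  rw [e1] at b2 b3 b4
  rw [e2] at c2 c3 c4
  refine ⟨a1, b1, c1, sl_bound _ (fun x y z => slInd_le _ _), fun hh => ?_, fun b hb => ?_⟩
  · by_cases h12 : 4 ≤ slP EE 0 1 ∧ 4 ≤ slP EE 0 2
    · obtain ⟨_, _, _, s4, _⟩ := sl_shape h (b := 0) (c := 1) (d := 2) (by decide) (by decide) (by decide)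
      obtain ⟨_, _, _, r4, _⟩ := sl_shape h (b := 0) (c := 2) (d := 1) (by decide) (by decide) (by decide)
      have := sl_T20 h (b := 0) (c := 1) (d := 2) (by decide) (by decide) (by decide) (s4 h12.1).1 (s4 h12.1).2
        (r4 h12.2).1 (r4 h12.2).2
      omega
    · omega
  · fin_cases b
    · exact sl_TQ h (by decide) (by decide) (by decide) hb
    · rw [slT_swap']; exact sl_TQ h (by decide) (by decide) (by decide) hb
    · rw [slT_swap, slT_swap']; exact sl_TQ h (by decide) (by decide) (by decide) hb

lemma sl_q0 (h : SLLoc EE) (b x : Fin 3) (hx : x ≠ 0) (hq0 : EE {(b, x)})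
    (hq : EE {(b, 0)}) : False := by
  have key : ∀ b : Fin 3, ∃ c d : Fin 3, b ≠ c ∧ b ≠ d ∧ c ≠ d := by decide
  obtain ⟨c, d, hbc, hbd, hcd⟩ := key b
  refine h.nb _ _ _ hq0 hq (h.medge c) ?_ ?_ ?_ d ?_ ?_ ?_ <;>
      simp [hbc, hbd, hcd, hbc.symm, hbd.symm, hcd.symm, hx, hx.symm]

lemma sl_s3 (h : SLLoc EE) (hbc : b ≠ c) (hbd : b ≠ d) (hcd : c ≠ d) (hb : EE {(b, 0)}) (hc : EE {(c, 0)})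
    (x y z : Fin 3) (hx : x ≠ 0) (hy : y ≠ 0) (hz : z ≠ 0) :
    ¬ EE {(b, x), (c, y), (d, z)} ∧ ¬ EE {(b, x), (c, y)} := by
  constructor
  · intro hE
    refine h.nb _ _ _ hb hc hE ?_ ?_ ?_ d ?_ ?_ ?_ <;>
      simp [hbc, hbd, hcd, hbc.symm, hbd.symm, hcd.symm, hx, hx.symm, hy, hy.symm, hz, hz.symm]
  · intro hE
    refine h.nb _ _ _ hb hc hE ?_ ?_ ?_ d ?_ ?_ ?_ <;>
      simp [hbc, hbd, hcd, hbc.symm, hbd.symm, hcd.symm, hx, hx.symm, hy, hy.symm, hz, hz.symm]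
end


/-! ### Maximum matching, extendable sets -/

/-- `v` indexes a maximum matching of the stable 3-graph `H`. -/
structure SLSet (n s : ℕ) (H : Finset (Finset ℕ)) (v : Fin s → Fin 3 → ℕ) : Prop where
  hK : IsKGraphOn n 3 H
  hS : StableGraph n H
  lt01 : ∀ a, v a 0 < v a 1
  lt12 : ∀ a, v a 1 < v a 2
  edge : ∀ a, {v a 0, v a 1, v a 2} ∈ H
  inj : ∀ a b x y, v a x = v b y → a = b
  max : ∀ M ⊆ H, IsMatching M → M.card ≤ s

def slv {s : ℕ} (v : Fin s → Fin 3 → ℕ) (p : Fin s × Fin 3) : ℕ := v p.1 p.2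

def slW {s : ℕ} (v : Fin s → Fin 3 → ℕ) : Finset ℕ := univ.image (slv v)

def SLExt (H : Finset (Finset ℕ)) {s : ℕ} (v : Fin s → Fin 3 → ℕ) (g : Finset (Fin s × Fin 3)) : Prop :=
  ∀ X : Finset ℕ, X.card ≤ 30 → ∃ e ∈ H, e ∩ slW v = g.image (slv v) ∧ Disjoint (e \ slW v) X

section
variable {n s : ℕ} {H : Finset (Finset ℕ)} {v : Fin s → Fin 3 → ℕ}

lemma SLSet.mono (h : SLSet n s H v) (a : Fin s) {x y : Fin 3} (hxy : x ≤ y) : v a x ≤ v a y := by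
  have h1 := h.lt01 a
  have h2 := h.lt12 a
  fin_cases x <;> fin_cases y <;> simp at hxy ⊢ <;> omega

lemma SLSet.vinj (h : SLSet n s H v) : Function.Injective (slv v) := by
  rintro ⟨a, x⟩ ⟨b, y⟩ hxy
  simp only [slv] at hxy
  obtain rfl := h.inj a b x y hxy
  have h1 := h.lt01 a
  have h2 := h.lt12 a
  fin_cases x <;> fin_cases y <;> simp at hxy ⊢ <;> omega

lemma SLSet.ne (h : SLSet n s H v) {p q : Fin s × Fin 3} (hpq : p ≠ q) : v p.1 p.2 ≠ v q.1 q.2 :=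
  fun hh => hpq (h.vinj hh)

lemma sl_memW (a : Fin s) (x : Fin 3) : v a x ∈ slW v :=
  mem_image.2 ⟨(a, x), mem_univ _, rfl⟩

lemma SLSet.pos (h : SLSet n s H v) (a : Fin s) (x : Fin 3) : 1 ≤ v a x ∧ v a x ≤ n := by
  have := (h.hK _ (h.edge a)).1
  have h3 : v a x ∈ ({v a 0, v a 1, v a 2} : Finset ℕ) := by fin_cases x <;> simp
  simpa using this h3

lemma SLSet.cardW (h : SLSet n s H v) : (slW v).card = 3 * s := by
  rw [slW, card_image_of_injective _ h.vinj]
  simp [Fintype.card_prod, mul_comm]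

lemma SLSet.Wsub (h : SLSet n s H v) : slW v ⊆ Icc 1 n := by
  intro w hw
  obtain ⟨p, _, rfl⟩ := mem_image.1 hw
  exact mem_Icc.2 (h.pos p.1 p.2)

lemma sl_image_subW (g : Finset (Fin s × Fin 3)) : g.image (slv v) ⊆ slW v :=
  image_subset_image (subset_univ _)

/-- edges inside `W` are extendable -/
lemma sl_ext_edge (g : Finset (Fin s × Fin 3)) (hg : g.image (slv v) ∈ H) : SLExt H v g := by
  intro X _
  refine ⟨_, hg, inter_eq_left.2 (sl_image_subW g), ?_⟩
  rw [sdiff_eq_empty_iff_subset.2 (sl_image_subW g)]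
  exact disjoint_empty_left _

lemma sl_pick (h : SLSet n s H v) (L : List (Finset (Fin s × Fin 3))) (hl : L.length ≤ 10)
    (hd : L.Pairwise Disjoint) (hE : ∀ g ∈ L, SLExt H v g) :
    ∃ M ⊆ H, IsMatching M ∧ M.card = L.length ∧ ∀ e ∈ M, ∃ g ∈ L, e ∩ slW v = g.image (slv v) := by
  induction L with
  | nil => exact ⟨∅, by simp, by intro e he; simp at he, by simp, by simp⟩
  | cons g L ih =>
    rw [List.pairwise_cons] at hd
    simp only [List.length_cons] at hl
    obtain ⟨M, hMH, hM, hMc, hMg⟩ := ih (by omega) hd.2 (fun g' hg' => hE g' (List.mem_cons_of_mem _ hg'))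
    have hX : (M.biUnion id).card ≤ 30 := by
      have : (M.biUnion id).card ≤ M.card * 3 := by
        apply card_biUnion_le_card_mul
        intro e he
        exact (h.hK e (hMH he)).2.le
      omega
    obtain ⟨e, heH, heW, heX⟩ := hE g (List.mem_cons_self) _ hX
    have hdis : ∀ f ∈ M, Disjoint e f := by
      intro f hf
      rw [disjoint_left]
      intro x hxe hxf
      by_cases hxW : x ∈ slW v
      · obtain ⟨g', hg', hfg⟩ := hMg f hf
        have h1 : x ∈ g.image (slv v) := by rw [← heW]; exact mem_inter.2 ⟨hxe, hxW⟩
        have h2 : x ∈ g'.image (slv v) := by rw [← hfg]; exact mem_inter.2 ⟨hxf, hxW⟩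
        have := (disjoint_image h.vinj).2 (hd.1 g' hg')
        exact (disjoint_left.1 this) h1 h2
      · exact (disjoint_left.1 heX) (mem_sdiff.2 ⟨hxe, hxW⟩) (mem_biUnion.2 ⟨f, hf, hxf⟩)
    have hne : e.Nonempty := by
      rw [← card_pos, (h.hK e heH).2]; omega
    have heM : e ∉ M := fun he => by
      have := hdis e he
      rw [disjoint_self] at this
      simp [this] at hne
    refine ⟨insert e M, insert_subset heH hMH, ?_, ?_, ?_⟩
    · intro a ha b hb hab
      rcases mem_insert.1 ha with ha' | ha' <;> rcases mem_insert.1 hb with hb' | hb'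
      · exact absurd (ha'.trans hb'.symm) hab
      · rw [ha']; exact hdis b hb'
      · rw [hb']; exact (hdis a ha').symm
      · exact hM a ha' b hb' hab
    · rw [card_insert_of_notMem heM, hMc]; rfl
    · intro f hf
      rcases mem_insert.1 hf with rfl | hf
      · exact ⟨g, List.mem_cons_self, heW⟩
      · obtain ⟨g', hg', h'⟩ := hMg f hf
        exact ⟨g', List.mem_cons_of_mem _ hg', h'⟩

def slE {s : ℕ} (v : Fin s → Fin 3 → ℕ) (a : Fin s) : Finset ℕ := {v a 0, v a 1, v a 2}

lemma sl_mem_E {a : Fin s} {w : ℕ} : w ∈ slE v a ↔ ∃ x, v a x = w := by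
  simp only [slE, mem_insert, mem_singleton]
  constructor
  · rintro (rfl | rfl | rfl)
    exacts [⟨0, rfl⟩, ⟨1, rfl⟩, ⟨2, rfl⟩]
  · rintro ⟨x, rfl⟩; fin_cases x <;> simp

lemma sl_swap_false (h : SLSet n s H v) (L : List (Finset (Fin s × Fin 3))) (hl : L.length ≤ 10)
    (hd : L.Pairwise Disjoint) (hE : ∀ g ∈ L, SLExt H v g) (J : Finset (Fin s))
    (hJ : J.card + 1 ≤ L.length) (hs : ∀ g ∈ L, ∀ p ∈ g, p.1 ∈ J) : False := by
  obtain ⟨M, hMH, hM, hMc, hMg⟩ := sl_pick h L hl hd hE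
  have hEinj : Set.InjOn (slE v) (Jᶜ : Finset (Fin s)) := by
    intro a _ b _ hab
    have : v a 0 ∈ slE v b := by rw [← hab]; exact sl_mem_E.2 ⟨0, rfl⟩
    obtain ⟨x, hx⟩ := sl_mem_E.1 this
    exact (h.inj _ _ _ _ hx).symm
  have hdis : ∀ e ∈ M, ∀ a ∈ Jᶜ, Disjoint e (slE v a) := by
    intro e he a ha
    rw [disjoint_left]
    intro w hwe hwa
    obtain ⟨x, rfl⟩ := sl_mem_E.1 hwa
    obtain ⟨g, hg, heg⟩ := hMg e he
    have : v a x ∈ g.image (slv v) := by rw [← heg]; exact mem_inter.2 ⟨hwe, sl_memW a x⟩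
    obtain ⟨p, hp, hpx⟩ := mem_image.1 this
    have h1 := hs g hg p hp
    rw [h.inj _ _ _ _ hpx] at h1
    exact (mem_compl.1 ha) h1
  have hdM : Disjoint M (Jᶜ.image (slE v)) := by
    rw [disjoint_left]
    intro e he he'
    obtain ⟨a, ha, rfl⟩ := mem_image.1 he'
    have := hdis _ he a ha
    rw [disjoint_self] at this
    have h2 : v a 0 ∈ slE v a := sl_mem_E.2 ⟨0, rfl⟩
    simp [this] at h2
  have hmax := h.max (M ∪ Jᶜ.image (slE v)) ?_ ?_
  · rw [card_union_of_disjoint hdM, card_image_of_injOn hEinj, card_compl, Fintype.card_fin, hMc] at hmax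
    have : J.card ≤ s := by simpa using card_le_univ J
    omega
  · apply union_subset hMH
    intro e he
    obtain ⟨a, ha, rfl⟩ := mem_image.1 he
    exact h.edge a
  · intro e he f hf hef
    rcases mem_union.1 he with he | he <;> rcases mem_union.1 hf with hf | hf
    · exact hM e he f hf hef
    · obtain ⟨a, ha, rfl⟩ := mem_image.1 hf
      exact hdis e he a ha
    · obtain ⟨a, ha, rfl⟩ := mem_image.1 he
      exact (hdis f hf a ha).symm
    · obtain ⟨a, ha, rfl⟩ := mem_image.1 he
      obtain ⟨b, hb, rfl⟩ := mem_image.1 hf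
      rw [disjoint_left]
      intro w hwa hwb
      obtain ⟨x, rfl⟩ := sl_mem_E.1 hwa
      obtain ⟨y, hy⟩ := sl_mem_E.1 hwb
      exact hef (by rw [h.inj _ _ _ _ hy])

/-- monotonicity for pairs -/
lemma sl_ext_mono2 (h : SLSet n s H v) {b c : Fin s} (hbc : b ≠ c) {x x' y : Fin 3} (hx : x' ≤ x)
    (hE : SLExt H v {(b, x), (c, y)}) : SLExt H v {(b, x'), (c, y)} := by
  intro X hX
  obtain ⟨e, he, heW, heX⟩ := hE X hX
  have hc3 := (h.hK e he).2
  have hbx : v b x ≠ v c y := fun hh => hbc (h.inj _ _ _ _ hh)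
  have hbx' : v b x' ≠ v c y := fun hh => hbc (h.inj _ _ _ _ hh)
  simp only [image_insert, image_singleton, slv] at heW
  have hc2 : (e ∩ slW v).card = 2 := by rw [heW, card_pair hbx]
  have hc1 : (e \ slW v).card = 1 := by
    have := card_inter_add_card_sdiff e (slW v); omega
  obtain ⟨z, hz⟩ := card_eq_one.1 hc1
  have hzW : z ∈ e \ slW v := by rw [hz]; simp
  have hzW' := (mem_sdiff.1 hzW).2
  have hze := (mem_sdiff.1 hzW).1
  have n1 : ∀ a t, v a t ≠ z := fun a t hh => hzW' (hh ▸ sl_memW a t)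
  have hee : e = {v b x, v c y, z} := by
    have := sdiff_union_inter e (slW v)
    rw [← this, hz, heW]; ext w; simp; tauto
  have hzp := (h.hK e he).1 hze
  have hmem : ({v b x', v c y, z} : Finset ℕ) ∈ H :=
    sl_stab h.hK h.hS hbx (n1 _ _) (n1 _ _) hbx' (n1 _ _) (n1 _ _) (h.mono b hx) le_rfl le_rfl
      (h.pos _ _).1 (h.pos _ _).1 (mem_Icc.1 hzp).1 (hee ▸ he)
  refine ⟨_, hmem, ?_, ?_⟩
  · ext w; simp only [mem_inter, mem_insert, mem_singleton, image_insert, image_singleton, slv]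
    constructor
    · rintro ⟨rfl | rfl | rfl, hw⟩
      · simp
      · simp
      · exact absurd hw hzW'
    · rintro (rfl | rfl)
      · simp [sl_memW]
      · simp [sl_memW]
  · have : ({v b x', v c y, z} : Finset ℕ) \ slW v = {z} := by
      ext w; simp only [mem_sdiff, mem_insert, mem_singleton]
      constructor
      · rintro ⟨rfl | rfl | rfl, hw⟩
        · exact absurd (sl_memW _ _) hw
        · exact absurd (sl_memW _ _) hw
        · rfl
      · rintro rfl; simp [hzW']
    rw [this, ← hz]; exact heX

lemma sl_ext_mono1 (h : SLSet n s H v) {b : Fin s} {x x' : Fin 3} (hx : x' ≤ x)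
    (hE : SLExt H v {(b, x)}) : SLExt H v {(b, x')} := by
  intro X hX
  obtain ⟨e, he, heW, heX⟩ := hE X hX
  have hc3 := (h.hK e he).2
  simp only [image_singleton, slv] at heW
  have hc2 : (e ∩ slW v).card = 1 := by rw [heW, card_singleton]
  have hc1 : (e \ slW v).card = 2 := by
    have := card_inter_add_card_sdiff e (slW v); omega
  obtain ⟨y, z, hyz, hz⟩ := card_eq_two.1 hc1
  have hyW : y ∈ e \ slW v := by rw [hz]; simp
  have hzW : z ∈ e \ slW v := by rw [hz]; simp
  have hyW' := (mem_sdiff.1 hyW).2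
  have hzW' := (mem_sdiff.1 hzW).2
  have n1 : ∀ a t, v a t ≠ z := fun a t hh => hzW' (hh ▸ sl_memW a t)
  have n2 : ∀ a t, v a t ≠ y := fun a t hh => hyW' (hh ▸ sl_memW a t)
  have hee : e = {v b x, y, z} := by
    have := sdiff_union_inter e (slW v)
    rw [← this, hz, heW]; ext w; simp; tauto
  have hyp := (h.hK e he).1 (mem_sdiff.1 hyW).1
  have hzp := (h.hK e he).1 (mem_sdiff.1 hzW).1
  have hmem : ({v b x', y, z} : Finset ℕ) ∈ H :=
    sl_stab h.hK h.hS (n2 _ _) (n1 _ _) hyz (n2 _ _) (n1 _ _) hyz (h.mono b hx) le_rfl le_rfl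
      (h.pos _ _).1 (mem_Icc.1 hyp).1 (mem_Icc.1 hzp).1 (hee ▸ he)
  refine ⟨_, hmem, ?_, ?_⟩
  · ext w; simp only [mem_inter, mem_insert, mem_singleton, image_singleton, slv]
    constructor
    · rintro ⟨rfl | rfl | rfl, hw⟩
      · rfl
      · exact absurd hw hyW'
      · exact absurd hw hzW'
    · rintro rfl
      simp [sl_memW]
  · have : ({v b x', y, z} : Finset ℕ) \ slW v = {y, z} := by
      ext w; simp only [mem_sdiff, mem_insert, mem_singleton]
      constructor
      · rintro ⟨rfl | rfl | rfl, hw⟩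
        · exact absurd (sl_memW _ _) hw
        · simp
        · simp
      · rintro (rfl | rfl)
        · simp [hyW']
        · simp [hzW']
    rw [this, ← hz]; exact heX

/-- three smallest vertices of distinct matching edges form an edge -/
lemma sl_iii (h : SLSet n s H v) {a b c : Fin s} (hab : a ≠ b) (hac : a ≠ c) (hbc : b ≠ c) :
    ({v a 0, v b 0, v c 0} : Finset ℕ) ∈ H := by
  have key : ∀ a b c : Fin s, a ≠ b → a ≠ c → b ≠ c → v a 0 ≤ v c 0 → v b 0 ≤ v c 0 →
      ({v a 0, v b 0, v c 0} : Finset ℕ) ∈ H := by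
    intro a b c hab hac hbc h1 h2
    have := h.lt01 c
    have := h.lt12 c
    have he := h.edge c
    have e2 : ({v c 0, v c 1, v c 2} : Finset ℕ) = {v c 2, v c 1, v c 0} := by
      ext w; simp; tauto
    rw [e2] at he
    exact sl_stab h.hK h.hS (by omega) (by omega) (by omega)
      (fun hh => hab (h.inj _ _ _ _ hh)) (fun hh => hac (h.inj _ _ _ _ hh))
      (fun hh => hbc (h.inj _ _ _ _ hh)) (by omega) (by omega) le_rfl
      (h.pos _ _).1 (h.pos _ _).1 (h.pos _ _).1 he
  rcases le_total (v a 0) (v c 0) with h1 | h1 <;> rcases le_total (v b 0) (v c 0) with h2 | h2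
  · exact key a b c hab hac hbc h1 h2
  · rw [sl_perm2]; exact key a c b hac hab hbc.symm (by omega) (by omega)
  · rw [sl_perm1, sl_perm2]; exact key b c a hbc hab.symm hac.symm (by omega) (by omega)
  · rcases le_total (v a 0) (v b 0) with h3 | h3
    · rw [sl_perm2]; exact key a c b hac hab hbc.symm (by omega) (by omega)
    · rw [sl_perm1, sl_perm2]; exact key b c a hbc hab.symm hac.symm (by omega) (by omega)

def slmap {s : ℕ} (σ : Fin 3 → Fin s) (p : Fin 3 × Fin 3) : Fin s × Fin 3 := (σ p.1, p.2)

lemma slmap_inj {σ : Fin 3 → Fin s} (hσ : Function.Injective σ) : Function.Injective (slmap σ) := by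
  rintro ⟨a, x⟩ ⟨b, y⟩ hh
  simp only [slmap, Prod.mk.injEq] at hh
  rw [hσ hh.1, hh.2]

def SLEE (H : Finset (Finset ℕ)) {s : ℕ} (v : Fin s → Fin 3 → ℕ) (σ : Fin 3 → Fin s)
    (t : Finset (Fin 3 × Fin 3)) : Prop := SLExt H v (t.image (slmap σ))

def SLBad (H : Finset (Finset ℕ)) {s : ℕ} (v : Fin s → Fin 3 → ℕ) (σ : Fin 3 → Fin s) : Prop :=
  Function.Injective σ ∧ ∃ s1 s2 s3 : Finset (Fin 3 × Fin 3), SLEE H v σ s1 ∧ SLEE H v σ s2 ∧ SLEE H v σ s3 ∧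
    Disjoint s1 s2 ∧ Disjoint s1 s3 ∧ Disjoint s2 s3 ∧
    ∃ b : Fin 3, (b, (0 : Fin 3)) ∉ s1 ∧ (b, (0 : Fin 3)) ∉ s2 ∧ (b, (0 : Fin 3)) ∉ s3

lemma sl_good_loc (h : SLSet n s H v) {σ : Fin 3 → Fin s} (hσ : Function.Injective σ)
    (hb : ¬ SLBad H v σ) : SLLoc (SLEE H v σ) where
  medge := by
    intro b
    apply sl_ext_edge
    simp only [image_insert, image_singleton, slmap, slv]
    exact h.edge _
  mono2 := by
    intro b c hbc x x' y hx hE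
    unfold SLEE at hE ⊢
    simp only [image_insert, image_singleton, slmap] at hE ⊢
    exact sl_ext_mono2 h (fun hh => hbc (hσ hh)) hx hE
  nb := by
    intro s1 s2 s3 h1 h2 h3 d12 d13 d23 b n1 n2 n3
    exact hb ⟨hσ, s1, s2, s3, h1, h2, h3, d12, d13, d23, b, n1, n2, n3⟩

lemma sl_three_bad (h : SLSet n s H v) {σ τ ρ : Fin 3 → Fin s} (h1 : SLBad H v σ) (h2 : SLBad H v τ)
    (h3 : SLBad H v ρ) (d12 : ∀ i j, σ i ≠ τ j) (d13 : ∀ i j, σ i ≠ ρ j) (d23 : ∀ i j, τ i ≠ ρ j) :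
    False := by
  obtain ⟨i1, a1, a2, a3, A1, A2, A3, ad12, ad13, ad23, p, p1, p2, p3⟩ := h1
  obtain ⟨i2, b1, b2, b3, B1, B2, B3, bd12, bd13, bd23, q, q1, q2, q3⟩ := h2
  obtain ⟨i3, c1, c2, c3, C1, C2, C3, cd12, cd13, cd23, r, r1, r2, r3⟩ := h3
  have D : ∀ {σ τ : Fin 3 → Fin s}, (∀ i j, σ i ≠ τ j) → ∀ a b : Finset (Fin 3 × Fin 3),
      Disjoint (a.image (slmap σ)) (b.image (slmap τ)) := by
    intro σ τ hd a b
    rw [disjoint_left]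
    intro w h1 h2
    obtain ⟨x, _, rfl⟩ := mem_image.1 h1
    obtain ⟨y, _, hy⟩ := mem_image.1 h2
    simp only [slmap, Prod.mk.injEq] at hy
    exact hd _ _ hy.1.symm
  have S : ∀ {σ : Fin 3 → Fin s}, Function.Injective σ → ∀ {a b : Finset (Fin 3 × Fin 3)}, Disjoint a b →
      Disjoint (a.image (slmap σ)) (b.image (slmap σ)) := by
    intro σ hσ a b hab
    exact (disjoint_image (slmap_inj hσ)).2 hab
  set z : Finset (Fin s × Fin 3) := {(σ p, 0), (τ q, 0), (ρ r, 0)} with hz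
  have Z : ∀ {a : Finset (Fin 3 × Fin 3)} {π : Fin 3 → Fin s} , 
      (∀ x ∈ a, slmap π x ∉ z) → Disjoint (a.image (slmap π)) z := by
    intro a π hh
    rw [disjoint_left]
    intro w hw
    obtain ⟨x, hx, rfl⟩ := mem_image.1 hw
    exact hh x hx
  have Z1 : ∀ {a : Finset (Fin 3 × Fin 3)}, (p, (0 : Fin 3)) ∉ a → Disjoint (a.image (slmap σ)) z := by
    intro a ha; apply Z
    rintro ⟨x, y⟩ hx hm
    simp only [hz, slmap, mem_insert, mem_singleton, Prod.mk.injEq] at hm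
    rcases hm with hm | hm | hm
    · obtain ⟨e1, rfl⟩ := hm
      rw [i1 e1] at hx; exact ha hx
    · exact d12 _ _ hm.1
    · exact d13 _ _ hm.1
  have Z2 : ∀ {a : Finset (Fin 3 × Fin 3)}, (q, (0 : Fin 3)) ∉ a → Disjoint (a.image (slmap τ)) z := by
    intro a ha; apply Z
    rintro ⟨x, y⟩ hx hm
    simp only [hz, slmap, mem_insert, mem_singleton, Prod.mk.injEq] at hm
    rcases hm with hm | hm | hm
    · exact d12 _ _ hm.1.symm
    · obtain ⟨e1, rfl⟩ := hm
      rw [i2 e1] at hx; exact ha hx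
    · exact d23 _ _ hm.1
  have Z3 : ∀ {a : Finset (Fin 3 × Fin 3)}, (r, (0 : Fin 3)) ∉ a → Disjoint (a.image (slmap ρ)) z := by
    intro a ha; apply Z
    rintro ⟨x, y⟩ hx hm
    simp only [hz, slmap, mem_insert, mem_singleton, Prod.mk.injEq] at hm
    rcases hm with hm | hm | hm
    · exact d13 _ _ hm.1.symm
    · exact d23 _ _ hm.1.symm
    · obtain ⟨e1, rfl⟩ := hm
      rw [i3 e1] at hx; exact ha hx
  have zE : SLExt H v z := by
    apply sl_ext_edge
    simp only [hz, image_insert, image_singleton, slv]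
    exact sl_iii h (d12 _ _) (d13 _ _) (d23 _ _)
  refine sl_swap_false h [a1.image (slmap σ), a2.image (slmap σ), a3.image (slmap σ),
    b1.image (slmap τ), b2.image (slmap τ), b3.image (slmap τ),
    c1.image (slmap ρ), c2.image (slmap ρ), c3.image (slmap ρ), z] (by simp) ?_ ?_
    (univ.image σ ∪ univ.image τ ∪ univ.image ρ) ?_ ?_
  · simp only [List.pairwise_cons, List.mem_cons, List.not_mem_nil, or_false, forall_eq_or_imp, forall_eq,
      S i1 ad12, S i1 ad13, S i1 ad23, S i2 bd12, S i2 bd13, S i2 bd23, S i3 cd12, S i3 cd13, S i3 cd23,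
      D d12, D d13, D d23, Z1 p1, Z1 p2, Z1 p3, Z2 q1, Z2 q2, Z2 q3, Z3 r1, Z3 r2, Z3 r3, true_and, and_true,
      List.Pairwise.nil, IsEmpty.forall_iff, implies_true]
  · simp only [List.mem_cons, List.not_mem_nil, or_false, forall_eq_or_imp, forall_eq]
    exact ⟨A1, A2, A3, B1, B2, B3, C1, C2, C3, zE⟩
  · have t1 := card_union_le (univ.image σ ∪ univ.image τ) (univ.image ρ)
    have t2 := card_union_le (univ.image σ) (univ.image τ)
    have t3 : (univ.image σ).card ≤ 3 := by simpa using card_image_le (s := univ) (f := σ)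
    have t4 : (univ.image τ).card ≤ 3 := by simpa using card_image_le (s := univ) (f := τ)
    have t5 : (univ.image ρ).card ≤ 3 := by simpa using card_image_le (s := univ) (f := ρ)
    simp only [List.length_cons, List.length_nil]
    omega
  · simp only [List.mem_cons, List.not_mem_nil, or_false, forall_eq_or_imp, forall_eq, mem_union]
    refine ⟨?_, ?_, ?_, ?_, ?_, ?_, ?_, ?_, ?_, ?_⟩
    all_goals
      intro w hw
      simp only [hz, mem_insert, mem_singleton, mem_image, slmap] at hw
      first
        | (rcases hw with rfl | rfl | rfl <;> simp; done)
        | (obtain ⟨x, _, rfl⟩ := hw; simp; done)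

lemma sl_exists_B (h : SLSet n s H v) : ∃ B : Finset (Fin s), B.card ≤ 6 ∧
    ∀ σ : Fin 3 → Fin s, Function.Injective σ → (∀ i, σ i ∉ B) → SLLoc (SLEE H v σ) := by
  have t : ∀ σ : Fin 3 → Fin s, (univ.image σ).card ≤ 3 := fun σ => by
    simpa using card_image_le (s := univ) (f := σ)
  by_cases h1 : ∃ σ, SLBad H v σ
  · obtain ⟨σ, hσ⟩ := h1
    by_cases h2 : ∃ τ, SLBad H v τ ∧ ∀ i j, σ i ≠ τ j
    · obtain ⟨τ, hτ, hd⟩ := h2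
      refine ⟨univ.image σ ∪ univ.image τ, ?_, ?_⟩
      · have := card_union_le (univ.image σ) (univ.image τ)
        have := t σ
        have := t τ
        omega
      · intro ρ hρ hB
        refine sl_good_loc h hρ fun hbad => sl_three_bad h hσ hτ hbad hd ?_ ?_
        · intro i j hh; exact hB j (by rw [← hh]; simp)
        · intro i j hh; exact hB j (by rw [← hh]; simp)
    · refine ⟨univ.image σ, (t σ).trans (by omega), ?_⟩
      intro ρ hρ hB
      refine sl_good_loc h hρ fun hbad => h2 ⟨ρ, hbad, ?_⟩
      intro i j hh; exact hB j (by rw [← hh]; simp)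
  · exact ⟨∅, by simp, fun ρ hρ _ => sl_good_loc h hρ fun hbad => h1 ⟨ρ, hbad⟩⟩

end


/-! ### Counting -/

section
variable {n s : ℕ} {H : Finset (Finset ℕ)} {v : Fin s → Fin 3 → ℕ}

lemma sl_exists {m : ℕ} (hK : IsKGraphOn n 3 H) (hS : StableGraph n H)
    (hm : ∀ M ⊆ H, IsMatching M → M.card < m) :
    ∃ (s : ℕ) (v : Fin s → Fin 3 → ℕ), SLSet n s H v ∧ s + 1 ≤ m := by
  classical
  obtain ⟨M, hM, hmax⟩ := exists_max_image (H.powerset.filter IsMatching) card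
    ⟨∅, by simp [IsMatching]⟩
  rw [mem_filter, mem_powerset] at hM
  have hmax' : ∀ M' ⊆ H, IsMatching M' → M'.card ≤ M.card := fun M' h1 h2 =>
    hmax M' (mem_filter.2 ⟨mem_powerset.2 h1, h2⟩)
  let φ := M.equivFin.symm
  have h3 : ∀ a, (φ a : Finset ℕ).card = 3 := fun a => (hK _ (hM.1 (φ a).2)).2
  let v : Fin M.card → Fin 3 → ℕ := fun a x => (φ a : Finset ℕ).orderEmbOfFin (h3 a) x
  have hv : ∀ a x, v a x ∈ (φ a : Finset ℕ) := fun a x => orderEmbOfFin_mem _ _ _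
  have l01 : ∀ a, v a 0 < v a 1 := fun a => (OrderEmbedding.lt_iff_lt _).2 (by decide)
  have l12 : ∀ a, v a 1 < v a 2 := fun a => (OrderEmbedding.lt_iff_lt _).2 (by decide)
  refine ⟨M.card, v, ⟨hK, hS, l01, l12, ?_, ?_, hmax'⟩, hm M hM.1 hM.2⟩
  · intro a
    have : ({v a 0, v a 1, v a 2} : Finset ℕ) = φ a := by
      apply eq_of_subset_of_card_le
      · intro w hw
        simp only [mem_insert, mem_singleton] at hw
        rcases hw with rfl | rfl | rfl <;> exact hv _ _
      · rw [h3 a]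
        have := l01 a
        have := l12 a
        rw [card_eq_three.2 ⟨v a 0, v a 1, v a 2, by omega, by omega, by omega, rfl⟩]
    rw [this]; exact hM.1 (φ a).2
  · intro a b x y hxy
    by_contra hab
    have hne : (φ a : Finset ℕ) ≠ φ b := fun hh => hab (φ.injective (Subtype.ext hh))
    have := hM.2 _ (φ a).2 _ (φ b).2 hne
    exact (disjoint_left.1 this) (hv a x) (hxy ▸ hv b y)

lemma SLSet.meets (h : SLSet n s H v) {e : Finset ℕ} (he : e ∈ H) : ∃ a x, v a x ∈ e := by
  by_contra hc
  push Not at hc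
  have hEinj : Function.Injective (slE v) := by
    intro a b hab
    have : v a 0 ∈ slE v b := by rw [← hab]; exact sl_mem_E.2 ⟨0, rfl⟩
    obtain ⟨x, hx⟩ := sl_mem_E.1 this
    exact (h.inj _ _ _ _ hx).symm
  have hdis : ∀ a, Disjoint e (slE v a) := by
    intro a
    rw [disjoint_left]
    intro w hwe hwa
    obtain ⟨x, rfl⟩ := sl_mem_E.1 hwa
    exact hc _ _ hwe
  have hn : e ∉ univ.image (slE v) := by
    intro he'
    obtain ⟨a, _, rfl⟩ := mem_image.1 he'
    exact hc a 0 (sl_mem_E.2 ⟨0, rfl⟩)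
  have hmax := h.max (insert e (univ.image (slE v))) ?_ ?_
  · rw [card_insert_of_notMem hn, card_image_of_injective _ hEinj] at hmax
    simp at hmax
  · apply insert_subset he
    intro f hf
    obtain ⟨a, _, rfl⟩ := mem_image.1 hf
    exact h.edge a
  · intro f hf g hg hfg
    rcases mem_insert.1 hf with hf' | hf' <;> rcases mem_insert.1 hg with hg' | hg'
    · exact absurd (hf'.trans hg'.symm) hfg
    · obtain ⟨a, _, rfl⟩ := mem_image.1 hg'
      rw [hf']; exact hdis a
    · obtain ⟨a, _, rfl⟩ := mem_image.1 hf'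
      rw [hg']; exact (hdis a).symm
    · obtain ⟨a, _, rfl⟩ := mem_image.1 hf'
      obtain ⟨b, _, rfl⟩ := mem_image.1 hg'
      rw [disjoint_left]
      intro w hwa hwb
      obtain ⟨x, rfl⟩ := sl_mem_E.1 hwa
      obtain ⟨y, hy⟩ := sl_mem_E.1 hwb
      exact hfg (by rw [h.inj _ _ _ _ hy])

open Classical in
noncomputable def slx (H : Finset (Finset ℕ)) {s : ℕ} (v : Fin s → Fin 3 → ℕ) (g : Finset (Fin s × Fin 3)) : ℕ :=
  if SLExt H v g then 1 else 0

lemma sl_six (H' : Finset (Finset ℕ)) (hK : IsKGraphOn n 3 H') :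
    6 * H'.card ≤ (((Icc 1 n) ×ˢ (Icc 1 n) ×ˢ (Icc 1 n)).filter
      (fun t => ({t.1, t.2.1, t.2.2} : Finset ℕ) ∈ H')).card := by
  have hmt : Set.MapsTo (fun t : ℕ × ℕ × ℕ => ({t.1, t.2.1, t.2.2} : Finset ℕ))
      (((Icc 1 n) ×ˢ (Icc 1 n) ×ˢ (Icc 1 n)).filter
      (fun t => ({t.1, t.2.1, t.2.2} : Finset ℕ) ∈ H') : Finset (ℕ × ℕ × ℕ)) H' := fun t ht => (mem_filter.1 ht).2
  rw [card_eq_sum_card_fiberwise hmt, mul_comm, ← smul_eq_mul, ← sum_const]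
  apply sum_le_sum
  intro e he
  obtain ⟨hsub, hc⟩ := hK e he
  obtain ⟨x, y, z, hxy, hxz, hyz, rfl⟩ := card_eq_three.1 hc
  have hx := mem_Icc.1 (hsub (by simp : x ∈ ({x, y, z} : Finset ℕ)))
  have hy := mem_Icc.1 (hsub (by simp : y ∈ ({x, y, z} : Finset ℕ)))
  have hz := mem_Icc.1 (hsub (by simp : z ∈ ({x, y, z} : Finset ℕ)))
  have h6 : ({(x, y, z), (x, z, y), (y, x, z), (y, z, x), (z, x, y), (z, y, x)} : Finset (ℕ × ℕ × ℕ)).card = 6 := by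
    rw [card_insert_of_notMem, card_insert_of_notMem, card_insert_of_notMem, card_insert_of_notMem,
      card_insert_of_notMem, card_singleton] <;> simp [hxy, hxz, hyz, hxy.symm, hxz.symm, hyz.symm]
  rw [← h6]
  apply card_le_card
  intro t ht
  simp only [mem_insert, mem_singleton] at ht
  have e1 : ({x, z, y} : Finset ℕ) = {x, y, z} := by rw [sl_perm2 x z y]
  have e2 : ({y, x, z} : Finset ℕ) = {x, y, z} := by rw [sl_perm1 y x z]
  have e3 : ({y, z, x} : Finset ℕ) = {x, y, z} := by rw [sl_perm2 y z x, sl_perm1 y x z]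
  have e4 : ({z, x, y} : Finset ℕ) = {x, y, z} := by rw [sl_perm1 z x y, sl_perm2 x z y]
  have e5 : ({z, y, x} : Finset ℕ) = {x, y, z} := by rw [sl_perm1 z y x, sl_perm2 y z x, sl_perm1 y x z]
  simp only [mem_filter, mem_product, mem_Icc]
  rcases ht with rfl | rfl | rfl | rfl | rfl | rfl <;>
    simp only [e1, e2, e3, e4, e5, he, hx, hy, hz, and_self]

/-- fibre over a pair -/
lemma sl_fib2 (h : SLSet n s H v) (p q : Fin s × Fin 3) :
    (((Icc 1 n) \ slW v).filter (fun z => ({slv v p, slv v q, z} : Finset ℕ) ∈ H)).card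
      ≤ slx H v {p, q} * (n - 3 * s) + 30 := by
  have hr : ((Icc 1 n) \ slW v).card = n - 3 * s := by
    rw [card_sdiff_of_subset h.Wsub, h.cardW]; simp
  unfold slx
  split_ifs with hE
  · have := card_filter_le ((Icc 1 n) \ slW v) (fun z => ({slv v p, slv v q, z} : Finset ℕ) ∈ H)
    omega
  · unfold SLExt at hE
    push Not at hE
    obtain ⟨X, hX, hh⟩ := hE
    have : ((Icc 1 n) \ slW v).filter (fun z => ({slv v p, slv v q, z} : Finset ℕ) ∈ H) ⊆ X := by
      intro z hz
      rw [mem_filter, mem_sdiff] at hz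
      have pW : slv v p ∈ slW v := sl_memW _ _
      have qW : slv v q ∈ slW v := sl_memW _ _
      have := hh _ hz.2 ?_
      · by_contra hzX
        apply this
        rw [disjoint_left]
        intro w hw
        simp only [mem_sdiff, mem_insert, mem_singleton] at hw
        rcases hw with ⟨rfl | rfl | rfl, hw⟩
        · exact absurd pW hw
        · exact absurd qW hw
        · exact hzX
      · ext w
        simp only [mem_inter, mem_insert, mem_singleton, image_insert, image_singleton]
        constructor
        · rintro ⟨rfl | rfl | rfl, hw⟩
          · simp
          · simp
          · exact absurd hw hz.1.2
        · rintro (rfl | rfl)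
          · simp [pW]
          · simp [qW]
    have := card_le_card this
    omega

/-- fibre over a single vertex -/
lemma sl_fib1 (h : SLSet n s H v) (p : Fin s × Fin 3) :
    ((((Icc 1 n) \ slW v) ×ˢ ((Icc 1 n) \ slW v)).filter
      (fun z => ({slv v p, z.1, z.2} : Finset ℕ) ∈ H)).card
      ≤ slx H v {p} * (n - 3 * s) ^ 2 + 60 * n := by
  have hr : ((Icc 1 n) \ slW v).card = n - 3 * s := by
    rw [card_sdiff_of_subset h.Wsub, h.cardW]; simp
  set R := (Icc 1 n) \ slW v with hR
  unfold slx
  split_ifs with hE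
  · have := card_filter_le (R ×ˢ R) (fun z => ({slv v p, z.1, z.2} : Finset ℕ) ∈ H)
    rw [card_product, hr] at this
    nlinarith
  · unfold SLExt at hE
    push Not at hE
    obtain ⟨X, hX, hh⟩ := hE
    have : (R ×ˢ R).filter (fun z => ({slv v p, z.1, z.2} : Finset ℕ) ∈ H) ⊆ (X ×ˢ R) ∪ (R ×ˢ X) := by
      rintro ⟨y, z⟩ hz
      rw [mem_filter, mem_product] at hz
      obtain ⟨⟨hy, hz⟩, he⟩ := hz
      simp only at hy hz he
      have pW : slv v p ∈ slW v := sl_memW _ _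
      have := hh _ he ?_
      · rw [mem_union, mem_product, mem_product]
        by_contra hzX
        apply this
        rw [disjoint_left]
        intro w hw
        simp only [mem_sdiff, mem_insert, mem_singleton] at hw
        rcases hw with ⟨rfl | rfl | rfl, hw⟩
        · exact absurd pW hw
        · tauto
        · tauto
      · ext w
        simp only [mem_inter, mem_insert, mem_singleton, image_insert, image_singleton]
        constructor
        · rintro ⟨rfl | rfl | rfl, hw⟩
          · simp
          · exact absurd hw (mem_sdiff.1 hy).2
          · exact absurd hw (mem_sdiff.1 hz).2
        · rintro rfl
          simp [pW]
    have := card_le_card this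
    have h2 := card_union_le (X ×ˢ R) (R ×ˢ X)
    rw [card_product, card_product, hr] at h2
    have h3 : (n - 3 * s) ≤ n := Nat.sub_le _ _
    have h4 : X.card * (n - 3 * s) ≤ 30 * n := Nat.mul_le_mul hX h3
    nlinarith

set_option maxHeartbeats 1000000 in
lemma sl_count (h : SLSet n s H v) (B : Finset (Fin s)) (hB : B.card ≤ 6) (H' : Finset (Finset ℕ))
    (hH' : H' ⊆ H) (U : Finset (Fin 3)) (hU : ∀ e ∈ H', ∀ a x, v a x ∈ e → x ∈ U) (ι : ℕ)
    (hι : ι = 1 ∨ ∀ e ∈ H', ¬ e ⊆ slW v) :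
    6 * H'.card ≤ ι * (∑ p ∈ Bᶜ ×ˢ U, ∑ q ∈ Bᶜ ×ˢ U, ∑ r ∈ Bᶜ ×ˢ U, slx H v {p, q, r})
      + 3 * (n - 3 * s) * (∑ p ∈ Bᶜ ×ˢ U, ∑ q ∈ Bᶜ ×ˢ U, slx H v {p, q})
      + 3 * (n - 3 * s) ^ 2 * (∑ p ∈ Bᶜ ×ˢ U, slx H v {p}) + 324 * n ^ 2 := by
  classical
  set N := Icc 1 n with hN
  have hNc : N.card = n := by simp [hN]
  set R := N \ slW v with hR
  set A := Bᶜ ×ˢ U with hA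
  set WB := (B ×ˢ (univ : Finset (Fin 3))).image (slv v) with hWB
  have hWBc : WB.card ≤ 18 := by
    refine card_image_le.trans ?_
    rw [card_product]; simp; omega
  have h3s : 3 * s ≤ n := by
    have := card_le_card h.Wsub
    rw [h.cardW] at this; simpa using this
  have hAc : A.card ≤ n := by
    rw [hA, card_product]
    have h1 : Bᶜ.card ≤ s := by simpa using card_le_univ Bᶜ
    have h2 : U.card ≤ 3 := by simpa using card_le_univ U
    calc Bᶜ.card * U.card ≤ s * 3 := Nat.mul_le_mul h1 h2
      _ ≤ n := by omega
  set AAA := (A ×ˢ A ×ˢ A).filter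
    (fun t => ({slv v t.1, slv v t.2.1, slv v t.2.2} : Finset ℕ) ∈ H') with hAAA
  set AAR := (A ×ˢ A ×ˢ R).filter
    (fun t => ({slv v t.1, slv v t.2.1, t.2.2} : Finset ℕ) ∈ H') with hAAR
  set ARR := (A ×ˢ R ×ˢ R).filter
    (fun t => ({slv v t.1, t.2.1, t.2.2} : Finset ℕ) ∈ H') with hARR
  -- cardinalities
  have cAAA : AAA.card ≤ ι * (∑ p ∈ A, ∑ q ∈ A, ∑ r ∈ A, slx H v {p, q, r}) := by
    rcases hι with rfl | hι
    · rw [one_mul, hAAA, card_filter, sum_product]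
      apply sum_le_sum; intro p _
      rw [sum_product]
      apply sum_le_sum; intro q _
      apply sum_le_sum; intro r _
      simp only
      split_ifs with hh
      · unfold slx
        rw [if_pos]
        apply sl_ext_edge
        simp only [image_insert, image_singleton]
        exact hH' hh
      · exact Nat.zero_le _
    · have : AAA = ∅ := by
        rw [eq_empty_iff_forall_notMem]
        intro t ht
        rw [hAAA, mem_filter] at ht
        apply hι _ ht.2
        intro w hw
        simp only [mem_insert, mem_singleton] at hw
        rcases hw with rfl | rfl | rfl <;> exact sl_memW _ _
      rw [this]; simp
  have cAAR : AAR.card ≤ (n - 3 * s) * (∑ p ∈ A, ∑ q ∈ A, slx H v {p, q}) + 30 * n ^ 2 := by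
    have : AAR.card ≤ ∑ p ∈ A, ∑ q ∈ A, (slx H v {p, q} * (n - 3 * s) + 30) := by
      rw [hAAR, card_filter, sum_product]
      apply sum_le_sum; intro p _
      rw [sum_product]
      apply sum_le_sum; intro q _
      refine le_trans ?_ (sl_fib2 h p q)
      rw [card_filter]
      apply sum_le_sum; intro z _
      simp only
      split_ifs with h1 h2 h2
      · exact le_rfl
      · exact absurd (hH' h1) h2
      · exact Nat.zero_le _
      · exact le_rfl
    refine this.trans ?_
    simp only [sum_add_distrib, ← sum_mul, sum_const, smul_eq_mul]
    have : A.card * (A.card * 30) ≤ 30 * n ^ 2 := by nlinarith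
    rw [mul_comm (∑ p ∈ A, ∑ q ∈ A, slx H v {p, q})]
    exact add_le_add le_rfl (by linarith)
  have cARR : ARR.card ≤ (n - 3 * s) ^ 2 * (∑ p ∈ A, slx H v {p}) + 60 * n ^ 2 := by
    have : ARR.card ≤ ∑ p ∈ A, (slx H v {p} * (n - 3 * s) ^ 2 + 60 * n) := by
      rw [hARR, card_filter, sum_product]
      apply sum_le_sum; intro p _
      refine le_trans ?_ (sl_fib1 h p)
      rw [card_filter]
      apply sum_le_sum; intro z _
      simp only
      split_ifs with h1 h2 h2
      · exact le_rfl
      · exact absurd (hH' h1) h2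
      · exact Nat.zero_le _
      · exact le_rfl
    refine this.trans ?_
    simp only [sum_add_distrib, ← sum_mul, sum_const, smul_eq_mul]
    have : A.card * (60 * n) ≤ 60 * n ^ 2 := by nlinarith
    rw [mul_comm (∑ p ∈ A, slx H v {p})]
    exact add_le_add le_rfl (by linarith)
  -- cover
  set O := (N ×ˢ N ×ˢ N).filter (fun t => ({t.1, t.2.1, t.2.2} : Finset ℕ) ∈ H') with hO
  have hsix : 6 * H'.card ≤ O.card := sl_six H' (fun e he => h.hK e (hH' he))
  have trich : ∀ e ∈ H', ∀ w ∈ e, w ∈ WB ∨ (∃ p ∈ A, slv v p = w) ∨ w ∈ R := by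
    intro e he w hw
    by_cases hwW : w ∈ slW v
    · obtain ⟨⟨a, x⟩, _, rfl⟩ := mem_image.1 hwW
      by_cases ha : a ∈ B
      · left; exact mem_image.2 ⟨(a, x), by simp [ha], rfl⟩
      · right; left
        exact ⟨(a, x), mem_product.2 ⟨mem_compl.2 ha, hU e he a x hw⟩, rfl⟩
    · right; right
      exact mem_sdiff.2 ⟨(h.hK e (hH' he)).1 hw, hwW⟩
  have hcover : O ⊆ (WB ×ˢ N ×ˢ N) ∪ (N ×ˢ WB ×ˢ N) ∪ (N ×ˢ N ×ˢ WB)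
      ∪ AAA.image (fun t => (slv v t.1, slv v t.2.1, slv v t.2.2))
      ∪ AAR.image (fun t => (slv v t.1, slv v t.2.1, t.2.2))
      ∪ AAR.image (fun t => (slv v t.1, t.2.2, slv v t.2.1))
      ∪ AAR.image (fun t => (t.2.2, slv v t.1, slv v t.2.1))
      ∪ ARR.image (fun t => (slv v t.1, t.2.1, t.2.2))
      ∪ ARR.image (fun t => (t.2.1, slv v t.1, t.2.2))
      ∪ ARR.image (fun t => (t.2.1, t.2.2, slv v t.1)) := by
    rintro ⟨x, y, z⟩ ht
    rw [hO, mem_filter, mem_product, mem_product] at ht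
    obtain ⟨⟨hx, hy, hz⟩, he⟩ := ht
    simp only at hx hy hz he
    simp only [mem_union]
    rcases trich _ he x (by simp) with hx' | ⟨p, hp, rfl⟩ | hx'
    · simp [hx', hy, hz]
    · rcases trich _ he y (by simp) with hy' | ⟨q, hq, rfl⟩ | hy'
      · simp [hx, hy', hz]
      · rcases trich _ he z (by simp) with hz' | ⟨r, hr, rfl⟩ | hz'
        · simp [hx, hy, hz']
        · have : (slv v p, slv v q, slv v r) ∈ AAA.image (fun t => (slv v t.1, slv v t.2.1, slv v t.2.2)) :=
            mem_image.2 ⟨(p, q, r), mem_filter.2 ⟨by simp [hp, hq, hr], he⟩, rfl⟩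
          simp only [this, true_or, or_true]
        · have : (slv v p, slv v q, z) ∈ AAR.image (fun t => (slv v t.1, slv v t.2.1, t.2.2)) :=
            mem_image.2 ⟨(p, q, z), mem_filter.2 ⟨by simp [hp, hq, hz'], he⟩, rfl⟩
          simp only [this, true_or, or_true]
      · rcases trich _ he z (by simp) with hz' | ⟨r, hr, rfl⟩ | hz'
        · simp [hx, hy, hz']
        · have : (slv v p, y, slv v r) ∈ AAR.image (fun t => (slv v t.1, t.2.2, slv v t.2.1)) :=
            mem_image.2 ⟨(p, r, y), mem_filter.2 ⟨by simp [hp, hr, hy'], by rw [sl_perm2]; exact he⟩, rfl⟩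
          simp only [this, true_or, or_true]
        · have : (slv v p, y, z) ∈ ARR.image (fun t => (slv v t.1, t.2.1, t.2.2)) :=
            mem_image.2 ⟨(p, y, z), mem_filter.2 ⟨by simp [hp, hy', hz'], he⟩, rfl⟩
          simp only [this, true_or, or_true]
    · rcases trich _ he y (by simp) with hy' | ⟨q, hq, rfl⟩ | hy'
      · simp [hx, hy', hz]
      · rcases trich _ he z (by simp) with hz' | ⟨r, hr, rfl⟩ | hz'
        · simp [hx, hy, hz']
        · have : (x, slv v q, slv v r) ∈ AAR.image (fun t => (t.2.2, slv v t.1, slv v t.2.1)) :=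
            mem_image.2 ⟨(q, r, x), mem_filter.2 ⟨by simp [hq, hr, hx'], by
              rw [sl_perm2, sl_perm1]; exact he⟩, rfl⟩
          simp only [this, true_or, or_true]
        · have : (x, slv v q, z) ∈ ARR.image (fun t => (t.2.1, slv v t.1, t.2.2)) :=
            mem_image.2 ⟨(q, x, z), mem_filter.2 ⟨by simp [hq, hx', hz'], by rw [sl_perm1]; exact he⟩, rfl⟩
          simp only [this, true_or, or_true]
      · rcases trich _ he z (by simp) with hz' | ⟨r, hr, rfl⟩ | hz'
        · simp [hx, hy, hz']
        · have : (x, y, slv v r) ∈ ARR.image (fun t => (t.2.1, t.2.2, slv v t.1)) :=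
            mem_image.2 ⟨(r, x, y), mem_filter.2 ⟨by simp [hr, hx', hy'], by
              rw [sl_perm1, sl_perm2]; exact he⟩, rfl⟩
          simp only [this, true_or, or_true]
        · exfalso
          obtain ⟨a, t, hat⟩ := h.meets (hH' he)
          simp only [mem_insert, mem_singleton] at hat
          have := sl_memW (v := v) a t
          rcases hat with hh | hh | hh <;> rw [hh] at this
          · exact (mem_sdiff.1 hx').2 this
          · exact (mem_sdiff.1 hy').2 this
          · exact (mem_sdiff.1 hz').2 this
  have c1 : (WB ×ˢ N ×ˢ N).card ≤ 18 * n ^ 2 := by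
    rw [card_product, card_product, hNc, ← sq]; exact Nat.mul_le_mul_right _ hWBc
  have c2 : (N ×ˢ WB ×ˢ N).card ≤ 18 * n ^ 2 := by
    rw [card_product, card_product, hNc]; nlinarith
  have c3 : (N ×ˢ N ×ˢ WB).card ≤ 18 * n ^ 2 := by
    rw [card_product, card_product, hNc]; nlinarith
  have hfin := card_le_card hcover
  have i0 := card_image_le (s := AAA) (f := fun t => (slv v t.1, slv v t.2.1, slv v t.2.2))
  have i1 := card_image_le (s := AAR) (f := fun t => (slv v t.1, slv v t.2.1, t.2.2))
  have i2 := card_image_le (s := AAR) (f := fun t => (slv v t.1, t.2.2, slv v t.2.1))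
  have i3 := card_image_le (s := AAR) (f := fun t => (t.2.2, slv v t.1, slv v t.2.1))
  have i4 := card_image_le (s := ARR) (f := fun t => (slv v t.1, t.2.1, t.2.2))
  have i5 := card_image_le (s := ARR) (f := fun t => (t.2.1, slv v t.1, t.2.2))
  have i6 := card_image_le (s := ARR) (f := fun t => (t.2.1, t.2.2, slv v t.1))
  have hu : ∀ {X Y : Finset (ℕ × ℕ × ℕ)} {a b : ℕ}, X.card ≤ a → Y.card ≤ b → (X ∪ Y).card ≤ a + b :=
    fun {X Y a b} h1 h2 => (card_union_le X Y).trans (add_le_add h1 h2)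
  have hall := hfin.trans (hu (hu (hu (hu (hu (hu (hu (hu (hu c1 c2) c3) i0) i1) i2) i3) i4) i5) i6)
  rw [mul_assoc 3 (n - 3 * s), mul_assoc 3 ((n - 3 * s) ^ 2)]
  omega

end


/-! ### Weights -/

structure SLF (T P1 P2 P3 Q1 Q2 Q3 : ℕ) : Prop where
  p1 : P1 ≤ 5
  p2 : P2 ≤ 5
  p3 : P3 ≤ 5
  t : T ≤ 27
  tp : 1 ≤ P1 + P2 + P3 → 2 * T + (P1 + P2 + P3) ≤ 53
  tq1 : Q1 = 1 → T ≤ 19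
  tq2 : Q2 = 1 → T ≤ 19
  tq3 : Q3 = 1 → T ≤ 19
  q1 : Q1 ≤ 1
  q2 : Q2 ≤ 1
  q3 : Q3 ≤ 1

open Classical in
noncomputable def slO (P Q : ℕ) : ℝ := if Q = 3 ∨ (P = 0 ∧ Q = 0) then 0 else 1

lemma slO_nonneg (P Q : ℕ) : 0 ≤ slO P Q := by unfold slO; split_ifs <;> norm_num
lemma slO_le (P Q : ℕ) : slO P Q ≤ 1 := by unfold slO; split_ifs <;> norm_num

lemma sl_num {T P1 P2 P3 Q1 Q2 Q3 : ℕ} (h : SLF T P1 P2 P3 Q1 Q2 Q3) {g r F : ℝ} (hg : 0 ≤ g) (hr : 0 ≤ r)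
    (hF1 : 27 * g ^ 2 ≤ F) (hF2 : 19 * g ^ 2 + 15 * (g * r) + 3 * r ^ 2 ≤ F) :
    g ^ 2 * (T : ℝ) + g * r * ((P1 : ℝ) + P2 + P3) + r ^ 2 * ((Q1 : ℝ) + Q2 + Q3)
      ≤ F - 0.019 * (3 * g + r) ^ 2 * slO (P1 + P2 + P3) (Q1 + Q2 + Q3) := by
  obtain ⟨p1, p2, p3, t, tp, tq1, tq2, tq3, q1, q2, q3⟩ := h
  set P := P1 + P2 + P3 with hP
  set Q := Q1 + Q2 + Q3 with hQ
  have eP : ((P1 : ℝ) + P2 + P3) = P := by rw [hP]; push_cast; ring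
  have eQ : ((Q1 : ℝ) + Q2 + Q3) = Q := by rw [hQ]; push_cast; ring
  rw [eP, eQ]
  have P15 : (P : ℝ) ≤ 15 := by exact_mod_cast (show P ≤ 15 by omega)
  have P0 : (0 : ℝ) ≤ P := Nat.cast_nonneg _
  have hg2 : 0 ≤ g ^ 2 := sq_nonneg g
  have hr2 : 0 ≤ r ^ 2 := sq_nonneg r
  have hgr : 0 ≤ g * r := mul_nonneg hg hr
  have big : 19 * g ^ 2 + 15 * (g * r) + 2 * r ^ 2 ≤ F - 0.019 * (3 * g + r) ^ 2 := by
    have : 0 ≤ 0.229 * g ^ 2 - 0.864 * (g * r) + 0.831 * r ^ 2 := by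
      nlinarith [sq_nonneg (g - 1.886 * r), hr2, hg2]
    nlinarith
  have big2 : 26.5 * g ^ 2 ≤ F - 0.019 * (3 * g + r) ^ 2 := by nlinarith
  unfold slO
  split_ifs with hc
  · rcases hc with hc | ⟨hc1, hc2⟩
    · have hT : (T : ℝ) ≤ 19 := by exact_mod_cast tq1 (by omega)
      have hQ3 : (Q : ℝ) = 3 := by rw [hc]; norm_num
      rw [hQ3]
      nlinarith [mul_le_mul_of_nonneg_left hT hg2, mul_le_mul_of_nonneg_left P15 hgr]
    · have hT : (T : ℝ) ≤ 27 := by exact_mod_cast t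
      rw [hc1, hc2]; push_cast
      nlinarith [mul_le_mul_of_nonneg_left hT hg2]
  · rw [not_or] at hc
    by_cases hQ0 : Q = 0
    · have hP1 : 1 ≤ P := by omega
      have hh : 2 * (T : ℝ) + P ≤ 53 := by exact_mod_cast tp hP1
      rw [hQ0]; push_cast
      have h1 : g ^ 2 * (T : ℝ) ≤ g ^ 2 * ((53 - P) / 2) := mul_le_mul_of_nonneg_left (by linarith) hg2
      have h2 : (1 - (P : ℝ) / 15) * (26.5 * g ^ 2) ≤ (1 - (P : ℝ) / 15) * (F - 0.019 * (3 * g + r) ^ 2) :=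
        mul_le_mul_of_nonneg_left big2 (by linarith)
      have h3 : ((P : ℝ) / 15) * (19 * g ^ 2 + 15 * (g * r) + 2 * r ^ 2) ≤
          ((P : ℝ) / 15) * (F - 0.019 * (3 * g + r) ^ 2) :=
        mul_le_mul_of_nonneg_left big (by positivity)
      have h4 : 0 ≤ ((P : ℝ) / 15) * (2 * r ^ 2) := by positivity
      nlinarith
    · have hT : (T : ℝ) ≤ 19 := by
        have : Q1 = 1 ∨ Q2 = 1 ∨ Q3 = 1 := by omega
        rcases this with h | h | h
        · exact_mod_cast tq1 h
        · exact_mod_cast tq2 h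
        · exact_mod_cast tq3 h
      have hQ2 : (Q : ℝ) ≤ 2 := by exact_mod_cast (show Q ≤ 2 by omega)
      nlinarith [mul_le_mul_of_nonneg_left hT hg2, mul_le_mul_of_nonneg_left P15 hgr,
        mul_le_mul_of_nonneg_left hQ2 hr2]

section
variable {α : Type*} [DecidableEq α] (G : Finset α)

lemma sl_weight (t : α → α → α → ℝ) (p : α → α → ℝ) (q : α → ℝ) (r : ℝ) :
    (G.card : ℝ) ^ 2 * ((∑ a ∈ G, ∑ b ∈ G, ∑ c ∈ G, t a b c) + 3 * r * (∑ a ∈ G, ∑ b ∈ G, p a b)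
      + 3 * r ^ 2 * (∑ a ∈ G, q a)) =
    ∑ a ∈ G, ∑ b ∈ G, ∑ c ∈ G, ((G.card : ℝ) ^ 2 * t a b c + (G.card : ℝ) * r * (p a b + p a c + p b c)
      + r ^ 2 * (q a + q b + q c)) := by
  simp only [sum_add_distrib, ← mul_sum, sum_const, nsmul_eq_mul, mul_add]
  ring

noncomputable def slN (a b c : α) : ℝ := if a ≠ b ∧ a ≠ c ∧ b ≠ c then 0 else 1

lemma slN_sum : ∑ a ∈ G, ∑ b ∈ G, ∑ c ∈ G, slN a b c ≤ 3 * (G.card : ℝ) ^ 2 := by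
  have h1 : ∀ a b c : α, slN a b c ≤ (if a = b then (1 : ℝ) else 0) + (if a = c then 1 else 0)
      + (if b = c then 1 else 0) := by
    intro a b c
    unfold slN
    by_cases h1 : a = b <;> by_cases h2 : a = c <;> by_cases h3 : b = c <;> simp [h1, h2, h3] <;>
      (try norm_num) <;> simp_all
  calc _ ≤ ∑ a ∈ G, ∑ b ∈ G, ∑ c ∈ G, ((if a = b then (1 : ℝ) else 0) + (if a = c then 1 else 0)
      + (if b = c then 1 else 0)) := by
        apply sum_le_sum; intro a _; apply sum_le_sum; intro b _; apply sum_le_sum; intro c _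
        exact h1 a b c
    _ = 3 * (G.card : ℝ) ^ 2 := by
        simp only [sum_add_distrib, sum_ite_eq, sum_const, nsmul_eq_mul]
        have e1 : ∑ a ∈ G, ∑ b ∈ G, (if a = b then (1 : ℝ) else 0) = (G.card : ℝ) := by
          simp only [sum_ite_eq]
          simp
        have e2 : ∑ a ∈ G, (if a ∈ G then (1 : ℝ) else 0) = G.card := by
          simp
        simp only [e2, ← mul_sum, e1]
        ring

/-- summing a pointwise bound on weights -/
lemma sl_sumbound (V w : α → α → α → ℝ) (K C : ℝ) (hK : 0 ≤ C)
    (h : ∀ a ∈ G, ∀ b ∈ G, ∀ c ∈ G, V a b c ≤ w a b c + C * slN a b c) :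
    ∑ a ∈ G, ∑ b ∈ G, ∑ c ∈ G, V a b c ≤ (∑ a ∈ G, ∑ b ∈ G, ∑ c ∈ G, w a b c) + 3 * C * (G.card : ℝ) ^ 2 := by
  calc _ ≤ ∑ a ∈ G, ∑ b ∈ G, ∑ c ∈ G, (w a b c + C * slN a b c) := by
        apply sum_le_sum; intro a ha; apply sum_le_sum; intro b hb; apply sum_le_sum; intro c hc
        exact h a ha b hb c hc
    _ = (∑ a ∈ G, ∑ b ∈ G, ∑ c ∈ G, w a b c) + C * ∑ a ∈ G, ∑ b ∈ G, ∑ c ∈ G, slN a b c := by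
        simp only [sum_add_distrib, ← mul_sum]
    _ ≤ _ := by nlinarith [slN_sum G]

lemma sl_sum3 (u : α → ℝ) : ∑ a ∈ G, ∑ b ∈ G, ∑ c ∈ G, u a * u b * u c = (∑ a ∈ G, u a) ^ 3 := by
  simp only [mul_assoc, ← mul_sum, ← sum_mul]
  ring

end


section
variable {α : Type*} [DecidableEq α] (G : Finset α)

structure SLA (T T' : α → α → α → ℕ) (P P' : α → α → ℕ) (Q Q' q : α → ℕ) : Prop where
  ct : ∀ a b c, T a b c ≤ 27
  cp : ∀ a b, P a b ≤ 9
  cq : ∀ a, Q a ≤ 3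
  ct' : ∀ a b c, T' a b c ≤ 8
  cp' : ∀ a b, P' a b ≤ 4
  cq' : ∀ a, Q' a ≤ 2
  q1 : ∀ a, q a ≤ 1
  loc : ∀ a ∈ G, ∀ b ∈ G, ∀ c ∈ G, a ≠ b → a ≠ c → b ≠ c →
    SLF (T a b c) (P a b) (P a c) (P b c) (q a) (q b) (q c)
  qq : ∀ a ∈ G, ∀ b ∈ G, ∀ c ∈ G, a ≠ b → a ≠ c → b ≠ c →
    Q a = q a ∧ Q b = q b ∧ Q c = q c ∧ Q' a = 0 ∧ Q' b = 0 ∧ Q' c = 0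
  van : ∀ a ∈ G, ∀ b ∈ G, ∀ c ∈ G, a ≠ b → a ≠ c → b ≠ c → q a = 1 → q b = 1 → q c = 1 →
    T' a b c = 0 ∧ P' a b = 0 ∧ P' a c = 0 ∧ P' b c = 0

variable {G} {T T' : α → α → α → ℕ} {P P' : α → α → ℕ} {Q Q' q : α → ℕ}

noncomputable def slcO (G : Finset α) (P : α → α → ℕ) (q : α → ℕ) : ℝ :=
  ∑ a ∈ G, ∑ b ∈ G, ∑ c ∈ G, slO (P a b + P a c + P b c) (q a + q b + q c)

lemma sl_L4 (h : SLA G T T' P P' Q Q' q) :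
    3 * (G.card : ℝ) * (∑ a ∈ G, (q a : ℝ)) * ((G.card : ℝ) - ∑ a ∈ G, (q a : ℝ)) ≤ slcO G P q := by
  have e1 := sl_sum3 G (fun a => (q a : ℝ))
  have e2 := sl_sum3 G (fun a => 1 - (q a : ℝ))
  have e3 : ∑ a ∈ G, (1 - (q a : ℝ)) = (G.card : ℝ) - ∑ a ∈ G, (q a : ℝ) := by
    simp [sum_sub_distrib]
  have e4 : ∑ a ∈ G, ∑ b ∈ G, ∑ c ∈ G, (1 : ℝ) = (G.card : ℝ) ^ 3 := by
    simp; ring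
  have : ∑ a ∈ G, ∑ b ∈ G, ∑ c ∈ G, (1 - (q a : ℝ) * q b * q c - (1 - (q a : ℝ)) * (1 - (q b : ℝ)) * (1 - (q c : ℝ)))
      ≤ slcO G P q := by
    unfold slcO
    apply sum_le_sum; intro a _; apply sum_le_sum; intro b _; apply sum_le_sum; intro c _
    have ha := h.q1 a
    have hb := h.q1 b
    have hc := h.q1 c
    have hO := slO_nonneg (P a b + P a c + P b c) (q a + q b + q c)
    by_cases hm : q a + q b + q c = 3 ∨ q a + q b + q c = 0
    · have : (q a = 1 ∧ q b = 1 ∧ q c = 1) ∨ (q a = 0 ∧ q b = 0 ∧ q c = 0) := by omega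
      rcases this with ⟨h1, h2, h3⟩ | ⟨h1, h2, h3⟩ <;> rw [h1, h2, h3] at hO ⊢ <;> push_cast <;> linarith
    · have : slO (P a b + P a c + P b c) (q a + q b + q c) = 1 := by
        unfold slO; rw [if_neg (by tauto)]
      rw [this]
      have a0 : (0 : ℝ) ≤ q a := Nat.cast_nonneg _
      have b0 : (0 : ℝ) ≤ q b := Nat.cast_nonneg _
      have c0 : (0 : ℝ) ≤ q c := Nat.cast_nonneg _
      have a1 : (0 : ℝ) ≤ 1 - q a := by have : (q a : ℝ) ≤ 1 := (by exact_mod_cast ha); linarith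
      have b1 : (0 : ℝ) ≤ 1 - q b := by have : (q b : ℝ) ≤ 1 := (by exact_mod_cast hb); linarith
      have c1 : (0 : ℝ) ≤ 1 - q c := by have : (q c : ℝ) ≤ 1 := (by exact_mod_cast hc); linarith
      have := mul_nonneg (mul_nonneg a0 b0) c0
      have := mul_nonneg (mul_nonneg a1 b1) c1
      linarith
  simp only [sum_sub_distrib (s := G)] at this
  rw [e1, e2, e3, e4] at this
  nlinarith

lemma sl_crude {g r t p1 p2 p3 q1 q2 q3 : ℝ} (hg : 0 ≤ g) (hr : 0 ≤ r) (ht : t ≤ 27) (hp1 : p1 ≤ 9)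
    (hp2 : p2 ≤ 9) (hp3 : p3 ≤ 9) (hq1 : q1 ≤ 3) (hq2 : q2 ≤ 3) (hq3 : q3 ≤ 3) :
    g ^ 2 * t + g * r * (p1 + p2 + p3) + r ^ 2 * (q1 + q2 + q3) ≤ 9 * (3 * g + r) ^ 2 := by
  have h1 : g ^ 2 * t ≤ g ^ 2 * 27 := mul_le_mul_of_nonneg_left ht (sq_nonneg _)
  have h2 : g * r * (p1 + p2 + p3) ≤ g * r * 27 := mul_le_mul_of_nonneg_left (by linarith) (mul_nonneg hg hr)
  have h3 : r ^ 2 * (q1 + q2 + q3) ≤ r ^ 2 * 9 := mul_le_mul_of_nonneg_left (by linarith) (sq_nonneg _)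
  nlinarith [mul_nonneg hg hr, sq_nonneg g]

lemma sl_L1 (h : SLA G T T' P P' Q Q' q) {r F : ℝ} (hr : 0 ≤ r)
    (hF1 : 27 * (G.card : ℝ) ^ 2 ≤ F) (hF2 : 19 * (G.card : ℝ) ^ 2 + 15 * ((G.card : ℝ) * r) + 3 * r ^ 2 ≤ F) :
    (G.card : ℝ) ^ 2 * ((∑ a ∈ G, ∑ b ∈ G, ∑ c ∈ G, (T a b c : ℝ)) + 3 * r * (∑ a ∈ G, ∑ b ∈ G, (P a b : ℝ))
      + 3 * r ^ 2 * (∑ a ∈ G, (Q a : ℝ))) ≤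
    (G.card : ℝ) ^ 3 * F - 0.019 * (3 * (G.card : ℝ) + r) ^ 2 * slcO G P q
      + 30 * (3 * (G.card : ℝ) + r) ^ 2 * (G.card : ℝ) ^ 2 := by
  rw [sl_weight]
  set g : ℝ := (G.card : ℝ) with hg
  have hg0 : 0 ≤ g := Nat.cast_nonneg _
  have hn0 := sq_nonneg (3 * g + r)
  have := sl_sumbound G (w := fun a b c => F - 0.019 * (3 * g + r) ^ 2 *
      slO (P a b + P a c + P b c) (q a + q b + q c)) (K := 0) (C := 10 * (3 * g + r) ^ 2) (hK := by positivity)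
    (V := fun a b c => g ^ 2 * (T a b c : ℝ) + g * r * ((P a b : ℝ) + P a c + P b c)
      + r ^ 2 * ((Q a : ℝ) + Q b + Q c)) ?_
  · refine this.trans (le_of_eq ?_)
    unfold slcO
    simp only [sum_sub_distrib, ← mul_sum, sum_const, nsmul_eq_mul]
    ring
  · intro a ha b hb c hc
    by_cases hd : a ≠ b ∧ a ≠ c ∧ b ≠ c
    · have hN : slN a b c = 0 := by unfold slN; rw [if_pos hd]
      obtain ⟨h1, h2, h3⟩ := hd
      obtain ⟨e1, e2, e3, _⟩ := h.qq a ha b hb c hc h1 h2 h3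
      rw [hN, e1, e2, e3, mul_zero, add_zero]
      exact sl_num (h.loc a ha b hb c hc h1 h2 h3) hg0 hr hF1 hF2
    · have hN : slN a b c = 1 := by unfold slN; rw [if_neg hd]
      rw [hN]
      have := sl_crude (g := g) (r := r) hg0 hr (t := T a b c) (p1 := P a b) (p2 := P a c) (p3 := P b c) (q1 := Q a)
        (q2 := Q b) (q3 := Q c) (by exact_mod_cast h.ct _ _ _) (by exact_mod_cast h.cp _ _)
        (by exact_mod_cast h.cp _ _) (by exact_mod_cast h.cp _ _) (by exact_mod_cast h.cq _)
        (by exact_mod_cast h.cq _) (by exact_mod_cast h.cq _)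
      have hO := slO_le (P a b + P a c + P b c) (q a + q b + q c)
      have hO' := mul_le_mul_of_nonneg_left hO hn0
      have : 0 ≤ F := le_trans (by positivity) hF1
      nlinarith

lemma sl_L2 (h : SLA G T T' P P' Q Q' q) {r : ℝ} (hr : 0 ≤ r) :
    (G.card : ℝ) ^ 2 * (3 * r * (∑ a ∈ G, ∑ b ∈ G, (P a b : ℝ))
      + 3 * r ^ 2 * (∑ a ∈ G, (Q a : ℝ))) ≤
    3 * (3 * (G.card : ℝ) + r) ^ 2 * (slcO G P q + (∑ a ∈ G, (q a : ℝ)) ^ 3)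
      + 30 * (3 * (G.card : ℝ) + r) ^ 2 * (G.card : ℝ) ^ 2 := by
  have hw := sl_weight G (fun _ _ _ => (0 : ℝ)) (fun a b => (P a b : ℝ)) (fun a => (Q a : ℝ)) r
  simp only [sum_const_zero, zero_add] at hw
  rw [hw]
  set g : ℝ := (G.card : ℝ) with hg
  have hg0 : 0 ≤ g := Nat.cast_nonneg _
  have hn0 := sq_nonneg (3 * g + r)
  have := sl_sumbound G (w := fun a b c => 3 * (3 * g + r) ^ 2 *
      (slO (P a b + P a c + P b c) (q a + q b + q c) + (q a : ℝ) * q b * q c)) (K := 0) (C := 10 * (3 * g + r) ^ 2) (hK := by positivity)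
    (V := fun a b c => g ^ 2 * 0 + g * r * ((P a b : ℝ) + P a c + P b c)
      + r ^ 2 * ((Q a : ℝ) + Q b + Q c)) ?_
  · refine this.trans (le_of_eq ?_)
    rw [← sl_sum3]
    unfold slcO
    simp only [sum_add_distrib, ← mul_sum, sum_const, nsmul_eq_mul, mul_add]
    ring
  · intro a ha b hb c hc
    have hO := slO_nonneg (P a b + P a c + P b c) (q a + q b + q c)
    have hq0 : 0 ≤ (q a : ℝ) * q b * q c := by positivity
    by_cases hd : a ≠ b ∧ a ≠ c ∧ b ≠ c
    · have hN : slN a b c = 0 := by unfold slN; rw [if_pos hd]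
      obtain ⟨h1, h2, h3⟩ := hd
      obtain ⟨e1, e2, e3, _⟩ := h.qq a ha b hb c hc h1 h2 h3
      rw [hN, e1, e2, e3, mul_zero, mul_zero, add_zero]
      obtain ⟨p1, p2, p3, t, tp, tq1, tq2, tq3, q1, q2, q3⟩ := h.loc a ha b hb c hc h1 h2 h3
      by_cases hz : P a b + P a c + P b c = 0 ∧ q a + q b + q c = 0
      · have z1 : P a b = 0 := by omega
        have z2 : P a c = 0 := by omega
        have z3 : P b c = 0 := by omega
        have z4 : q a = 0 := by omega
        have z5 : q b = 0 := by omega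
        have z6 : q c = 0 := by omega
        have : 0 ≤ 3 * (3 * g + r) ^ 2 * (slO (P a b + P a c + P b c) (q a + q b + q c) + (q a : ℝ) * q b * q c) := by
          positivity
        rw [z1, z2, z3, z4, z5, z6] at this ⊢
        push_cast at this ⊢
        linarith
      · have h1 : 1 ≤ slO (P a b + P a c + P b c) (q a + q b + q c) + (q a : ℝ) * q b * q c := by
          by_cases h3 : q a + q b + q c = 3
          · have z4 : q a = 1 := by omega
            have z5 : q b = 1 := by omega
            have z6 : q c = 1 := by omega
            rw [z4, z5, z6] at hO ⊢
            push_cast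
            linarith
          · have : slO (P a b + P a c + P b c) (q a + q b + q c) = 1 := by
              unfold slO; rw [if_neg (by tauto)]
            linarith
        have h2 : g * r * ((P a b : ℝ) + P a c + P b c) ≤ g * r * 15 := by
          apply mul_le_mul_of_nonneg_left _ (mul_nonneg hg0 hr)
          exact_mod_cast (show P a b + P a c + P b c ≤ 15 by omega)
        have h3 : r ^ 2 * ((q a : ℝ) + q b + q c) ≤ r ^ 2 * 3 := by
          apply mul_le_mul_of_nonneg_left _ (sq_nonneg _)
          exact_mod_cast (show q a + q b + q c ≤ 3 by omega)
        have h4 := mul_le_mul_of_nonneg_left h1 hn0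
        nlinarith [mul_nonneg hg0 hr, sq_nonneg g]
    · have hN : slN a b c = 1 := by unfold slN; rw [if_neg hd]
      rw [hN]
      have := sl_crude (g := g) (r := r) hg0 hr (t := 0) (p1 := P a b) (p2 := P a c) (p3 := P b c) (q1 := Q a)
        (q2 := Q b) (q3 := Q c) (by norm_num) (by exact_mod_cast h.cp _ _)
        (by exact_mod_cast h.cp _ _) (by exact_mod_cast h.cp _ _) (by exact_mod_cast h.cq _)
        (by exact_mod_cast h.cq _) (by exact_mod_cast h.cq _)
      have : 0 ≤ 3 * (3 * g + r) ^ 2 * (slO (P a b + P a c + P b c) (q a + q b + q c) + (q a : ℝ) * q b * q c) := by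
        positivity
      linarith

lemma sl_L3 (h : SLA G T T' P P' Q Q' q) {r : ℝ} (hr : 0 ≤ r) :
    (G.card : ℝ) ^ 2 * ((∑ a ∈ G, ∑ b ∈ G, ∑ c ∈ G, (T' a b c : ℝ)) + 3 * r * (∑ a ∈ G, ∑ b ∈ G, (P' a b : ℝ))
      + 3 * r ^ 2 * (∑ a ∈ G, (Q' a : ℝ))) ≤
    9 / 7 * (3 * (G.card : ℝ) + r) ^ 2 * ((G.card : ℝ) ^ 3 - (∑ a ∈ G, (q a : ℝ)) ^ 3)
      + 30 * (3 * (G.card : ℝ) + r) ^ 2 * (G.card : ℝ) ^ 2 := by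
  rw [sl_weight]
  set g : ℝ := (G.card : ℝ) with hg
  have hg0 : 0 ≤ g := Nat.cast_nonneg _
  have hn0 := sq_nonneg (3 * g + r)
  have := sl_sumbound G (w := fun a b c => 9 / 7 * (3 * g + r) ^ 2 *
      (1 - (q a : ℝ) * q b * q c)) (K := 0) (C := 10 * (3 * g + r) ^ 2) (hK := by positivity)
    (V := fun a b c => g ^ 2 * (T' a b c : ℝ) + g * r * ((P' a b : ℝ) + P' a c + P' b c)
      + r ^ 2 * ((Q' a : ℝ) + Q' b + Q' c)) ?_
  · refine this.trans (le_of_eq ?_)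
    rw [← sl_sum3]
    simp only [sum_sub_distrib, ← mul_sum, sum_const, nsmul_eq_mul, mul_sub]
    ring
  · intro a ha b hb c hc
    have a0 : (0 : ℝ) ≤ q a := Nat.cast_nonneg _
    have b0 : (0 : ℝ) ≤ q b := Nat.cast_nonneg _
    have c0 : (0 : ℝ) ≤ q c := Nat.cast_nonneg _
    have a1 : (q a : ℝ) ≤ 1 := by exact_mod_cast h.q1 a
    have b1 : (q b : ℝ) ≤ 1 := by exact_mod_cast h.q1 b
    have c1 : (q c : ℝ) ≤ 1 := by exact_mod_cast h.q1 c
    have hS1 : 0 ≤ 1 - (q a : ℝ) * q b * q c := by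
      have := mul_le_one₀ (mul_le_one₀ a1 b0 b1) c0 c1
      linarith
    have hS0 : 0 ≤ 9 / 7 * (3 * g + r) ^ 2 * (1 - (q a : ℝ) * q b * q c) := mul_nonneg (by positivity) hS1
    by_cases hd : a ≠ b ∧ a ≠ c ∧ b ≠ c
    · have hN : slN a b c = 0 := by unfold slN; rw [if_pos hd]
      obtain ⟨h1, h2, h3⟩ := hd
      obtain ⟨_, _, _, e1, e2, e3⟩ := h.qq a ha b hb c hc h1 h2 h3
      rw [hN, e1, e2, e3, mul_zero, add_zero]
      by_cases hz : q a = 1 ∧ q b = 1 ∧ q c = 1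
      · obtain ⟨z1, z2, z3, z4⟩ := h.van a ha b hb c hc h1 h2 h3 hz.1 hz.2.1 hz.2.2
        rw [z1, z2, z3, z4]
        push_cast
        linarith
      · have : (q a : ℝ) * q b * q c = 0 := by
          have ha := h.q1 a
          have hb := h.q1 b
          have hc := h.q1 c
          have : q a = 0 ∨ q b = 0 ∨ q c = 0 := by omega
          rcases this with hh | hh | hh <;> rw [hh] <;> push_cast <;> ring
        rw [this]
        have h1 : g ^ 2 * (T' a b c : ℝ) ≤ g ^ 2 * 8 := by
          apply mul_le_mul_of_nonneg_left _ (sq_nonneg _)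
          exact_mod_cast h.ct' a b c
        have h2 : g * r * ((P' a b : ℝ) + P' a c + P' b c) ≤ g * r * 12 := by
          apply mul_le_mul_of_nonneg_left _ (mul_nonneg hg0 hr)
          have x1 := h.cp' a b
          have x2 := h.cp' a c
          have x3 := h.cp' b c
          exact_mod_cast (show P' a b + P' a c + P' b c ≤ 12 by omega)
        push_cast
        nlinarith [sq_nonneg (5 * g - 3 * r)]
    · have hN : slN a b c = 1 := by unfold slN; rw [if_neg hd]
      rw [hN]
      have := sl_crude (g := g) (r := r) hg0 hr (t := T' a b c) (p1 := P' a b) (p2 := P' a c) (p3 := P' b c)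
        (q1 := Q' a) (q2 := Q' b) (q3 := Q' c)
        (by exact_mod_cast (h.ct' _ _ _).trans (by norm_num)) (by exact_mod_cast (h.cp' _ _).trans (by norm_num))
        (by exact_mod_cast (h.cp' _ _).trans (by norm_num)) (by exact_mod_cast (h.cp' _ _).trans (by norm_num))
        (by exact_mod_cast (h.cq' _).trans (by norm_num)) (by exact_mod_cast (h.cq' _).trans (by norm_num))
        (by exact_mod_cast (h.cq' _).trans (by norm_num))
      linarith

end


section
variable {n s : ℕ} {H : Finset (Finset ℕ)} {v : Fin s → Fin 3 → ℕ}

noncomputable def slT3 (H : Finset (Finset ℕ)) {s : ℕ} (v : Fin s → Fin 3 → ℕ) (U : Finset (Fin 3))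
    (a b c : Fin s) : ℕ := ∑ x ∈ U, ∑ y ∈ U, ∑ z ∈ U, slx H v {(a, x), (b, y), (c, z)}
noncomputable def slP2 (H : Finset (Finset ℕ)) {s : ℕ} (v : Fin s → Fin 3 → ℕ) (U : Finset (Fin 3))
    (a b : Fin s) : ℕ := ∑ x ∈ U, ∑ y ∈ U, slx H v {(a, x), (b, y)}
noncomputable def slQ1 (H : Finset (Finset ℕ)) {s : ℕ} (v : Fin s → Fin 3 → ℕ) (U : Finset (Fin 3))
    (a : Fin s) : ℕ := ∑ x ∈ U, slx H v {(a, x)}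

lemma slx_le (g : Finset (Fin s × Fin 3)) : slx H v g ≤ 1 := by
  unfold slx; split_ifs <;> omega

lemma slx_pos {g : Finset (Fin s × Fin 3)} (h : slx H v g = 1) : SLExt H v g := by
  unfold slx at h; split_ifs at h with h1
  exact h1

lemma slx_zero {g : Finset (Fin s × Fin 3)} (h : ¬ SLExt H v g) : slx H v g = 0 := by
  unfold slx; rw [if_neg h]

lemma slInd_eq (σ : Fin 3 → Fin s) (t : Finset (Fin 3 × Fin 3)) :
    slInd (SLEE H v σ) t = slx H v (t.image (slmap σ)) := rfl

lemma slQ1_le (U : Finset (Fin 3)) (a : Fin s) : slQ1 H v U a ≤ U.card := by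
  unfold slQ1
  have := sum_le_card_nsmul U (fun x => slx H v {(a, x)}) 1 (fun x _ => slx_le _)
  simpa using this

lemma slP2_le (U : Finset (Fin 3)) (a b : Fin s) : slP2 H v U a b ≤ U.card * U.card := by
  unfold slP2
  have := sum_le_card_nsmul U (fun x => ∑ y ∈ U, slx H v {(a, x), (b, y)}) U.card (fun x _ => by
    have := sum_le_card_nsmul U (fun y => slx H v {(a, x), (b, y)}) 1 (fun x _ => slx_le _)
    simpa using this)
  simpa using this

lemma slT3_le (U : Finset (Fin 3)) (a b c : Fin s) : slT3 H v U a b c ≤ U.card * (U.card * U.card) := by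
  unfold slT3
  have := sum_le_card_nsmul U (fun x => ∑ y ∈ U, ∑ z ∈ U, slx H v {(a, x), (b, y), (c, z)})
    (U.card * U.card) (fun x _ => by
    have := sum_le_card_nsmul U (fun y => ∑ z ∈ U, slx H v {(a, x), (b, y), (c, z)}) U.card (fun y _ => by
      have := sum_le_card_nsmul U (fun z => slx H v {(a, x), (b, y), (c, z)}) 1 (fun x _ => slx_le _)
      simpa using this)
    simpa using this)
  simpa using this

lemma sl_sum_p3 {α : Type*} (G : Finset α) (U : Finset (Fin 3)) (f : α × Fin 3 → α × Fin 3 → α × Fin 3 → ℕ) :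
    ∑ p ∈ G ×ˢ U, ∑ q ∈ G ×ˢ U, ∑ r ∈ G ×ˢ U, f p q r =
      ∑ a ∈ G, ∑ b ∈ G, ∑ c ∈ G, ∑ x ∈ U, ∑ y ∈ U, ∑ z ∈ U, f (a, x) (b, y) (c, z) := by
  simp only [sum_product]
  apply sum_congr rfl; intro a _
  rw [sum_comm]
  apply sum_congr rfl; intro b _
  rw [sum_comm]
  have : ∀ y : Fin 3, ∑ x ∈ U, ∑ c ∈ G, ∑ z ∈ U, f (a, x) (b, y) (c, z) =
      ∑ c ∈ G, ∑ x ∈ U, ∑ z ∈ U, f (a, x) (b, y) (c, z) := fun y => sum_comm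
  simp only [this]
  rw [sum_comm]
  apply sum_congr rfl; intro c _
  rw [sum_comm]

lemma sl_sum_p2 {α : Type*} (G : Finset α) (U : Finset (Fin 3)) (f : α × Fin 3 → α × Fin 3 → ℕ) :
    ∑ p ∈ G ×ˢ U, ∑ q ∈ G ×ˢ U, f p q =
      ∑ a ∈ G, ∑ b ∈ G, ∑ x ∈ U, ∑ y ∈ U, f (a, x) (b, y) := by
  simp only [sum_product]
  apply sum_congr rfl; intro a _
  rw [sum_comm]

set_option maxHeartbeats 1000000 in
lemma sl_inst (h : SLSet n s H v) (B : Finset (Fin s))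
    (hB : ∀ σ : Fin 3 → Fin s, Function.Injective σ → (∀ i, σ i ∉ B) → SLLoc (SLEE H v σ)) :
    SLA Bᶜ (slT3 H v univ) (slT3 H v {1, 2}) (slP2 H v univ) (slP2 H v {1, 2}) (slQ1 H v univ)
      (slQ1 H v {1, 2}) (fun a => slx H v {(a, 0)}) := by
  have L : ∀ a ∈ Bᶜ, ∀ b ∈ Bᶜ, ∀ c ∈ Bᶜ, a ≠ b → a ≠ c → b ≠ c → SLLoc (SLEE H v ![a, b, c]) := by
    intro a ha b hb c hc hab hac hbc
    apply hB
    · intro i j hij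
      fin_cases i <;> fin_cases j <;> simp [hab, hac, hbc, hab.symm, hac.symm, hbc.symm] at hij ⊢
    · intro i
      fin_cases i
      exacts [mem_compl.1 ha, mem_compl.1 hb, mem_compl.1 hc]
  have c2 : ({1, 2} : Finset (Fin 3)).card = 2 := by decide
  have c3 : (univ : Finset (Fin 3)).card = 3 := by decide
  have qz : ∀ a ∈ Bᶜ, ∀ b ∈ Bᶜ, ∀ c ∈ Bᶜ, a ≠ b → a ≠ c → b ≠ c → ∀ x : Fin 3, x ≠ 0 →
      slx H v {(a, x)} = 0 := by
    intro a ha b hb c hc hab hac hbc x hx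
    apply slx_zero
    intro hE
    have hE0 : SLExt H v {(a, 0)} := sl_ext_mono1 h (Fin.zero_le x) hE
    refine sl_q0 (L a ha b hb c hc hab hac hbc) 0 x hx ?_ ?_
    · simpa [SLEE, slmap] using hE
    · simpa [SLEE, slmap] using hE0
  constructor
  · intro a b c; have := slT3_le (H := H) (v := v) univ a b c; rw [c3] at this; simpa using this
  · intro a b; have := slP2_le (H := H) (v := v) univ a b; rw [c3] at this; simpa using this
  · intro a; have := slQ1_le (H := H) (v := v) univ a; rw [c3] at this; simpa using this
  · intro a b c; have := slT3_le (H := H) (v := v) {1, 2} a b c; rw [c2] at this; simpa using this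
  · intro a b; have := slP2_le (H := H) (v := v) {1, 2} a b; rw [c2] at this; simpa using this
  · intro a; have := slQ1_le (H := H) (v := v) {1, 2} a; rw [c2] at this; simpa using this
  · intro a; exact slx_le _
  · intro a ha b hb c hc hab hac hbc
    have hl := sl_local (L a ha b hb c hc hab hac hbc)
    obtain ⟨l1, l2, l3, l4, l5, l6⟩ := hl
    have eT : slT (SLEE H v ![a, b, c]) 0 1 2 = slT3 H v univ a b c := by
      simp [slT, slT3, slInd_eq, slmap, image_insert]
    have e01 : slP (SLEE H v ![a, b, c]) 0 1 = slP2 H v univ a b := by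
      simp [slP, slP2, slInd_eq, slmap, image_insert]
    have e02 : slP (SLEE H v ![a, b, c]) 0 2 = slP2 H v univ a c := by
      simp [slP, slP2, slInd_eq, slmap, image_insert]
    have e12 : slP (SLEE H v ![a, b, c]) 1 2 = slP2 H v univ b c := by
      simp [slP, slP2, slInd_eq, slmap, image_insert]
    rw [e01] at l1; rw [e02] at l2; rw [e12] at l3; rw [eT] at l4; rw [eT, e01, e02, e12] at l5
    have l6b : ∀ i, SLEE H v ![a, b, c] {(i, 0)} → slT3 H v univ a b c ≤ 19 := fun i hi => eT ▸ l6 i hi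
    refine ⟨l1, l2, l3, l4, l5, ?_, ?_, ?_, slx_le _, slx_le _, slx_le _⟩
    · intro hq; apply l6b 0; simpa [SLEE, slmap] using slx_pos hq
    · intro hq; apply l6b 1; simpa [SLEE, slmap] using slx_pos hq
    · intro hq; apply l6b 2; simpa [SLEE, slmap] using slx_pos hq
  · intro a ha b hb c hc hab hac hbc
    have key : ∀ a : Fin s, (∀ x : Fin 3, x ≠ 0 → slx H v {(a, x)} = 0) →
        slQ1 H v univ a = slx H v {(a, 0)} ∧ slQ1 H v {1, 2} a = 0 := by
      intro a hz
      have h1 := hz 1 (by decide)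
      have h2 := hz 2 (by decide)
      constructor
      · simp [slQ1, Fin.sum_univ_three, h1, h2]
      · unfold slQ1; rw [sum_pair (by decide), h1, h2]
    have ka := key a (qz a ha b hb c hc hab hac hbc)
    have kb := key b (qz b hb a ha c hc hab.symm hbc hac)
    have kc := key c (qz c hc a ha b hb hac.symm hbc.symm hab)
    exact ⟨ka.1, kb.1, kc.1, ka.2, kb.2, kc.2⟩
  · intro a ha b hb c hc hab hac hbc qa qb qc
    have nz : ∀ x ∈ ({1, 2} : Finset (Fin 3)), x ≠ 0 := by decide
    have key : ∀ a ∈ Bᶜ, ∀ b ∈ Bᶜ, ∀ c ∈ Bᶜ, a ≠ b → a ≠ c → b ≠ c → slx H v {(a, 0)} = 1 →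
        slx H v {(b, 0)} = 1 → slT3 H v {1, 2} a b c = 0 ∧ slP2 H v {1, 2} a b = 0 := by
      intro a ha b hb c hc hab hac hbc qa qb
      have ll := L a ha b hb c hc hab hac hbc
      have ea : SLEE H v ![a, b, c] {(0, 0)} := by simpa [SLEE, slmap] using slx_pos qa
      have eb : SLEE H v ![a, b, c] {(1, 0)} := by simpa [SLEE, slmap] using slx_pos qb
      have hs := sl_s3 ll (b := 0) (c := 1) (d := 2) (by decide) (by decide) (by decide) ea eb
      constructor
      · apply sum_eq_zero; intro x hx; apply sum_eq_zero; intro y hy; apply sum_eq_zero; intro z hz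
        apply slx_zero
        have := (hs x y z (nz x hx) (nz y hy) (nz z hz)).1
        simpa [SLEE, slmap, image_insert] using this
      · apply sum_eq_zero; intro x hx; apply sum_eq_zero; intro y hy
        apply slx_zero
        have := (hs x y 1 (nz x hx) (nz y hy) (by decide)).2
        simpa [SLEE, slmap, image_insert] using this
    have k1 := key a ha b hb c hc hab hac hbc qa qb
    have k2 := key a ha c hc b hb hac hab hbc.symm qa qc
    have k3 := key b hb c hc a ha hbc hab.symm hac.symm qb qc
    exact ⟨k1.1, k1.2, k2.2, k3.2⟩

lemma sl_rank (A : Finset ℕ) {N : ℕ} (hc : A.card = N) (i : Fin N) :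
    (A.filter (· < A.orderEmbOfFin hc i)).card = i := by
  have : A.filter (· < A.orderEmbOfFin hc i) = (Iio i).map (A.orderEmbOfFin hc).toEmbedding := by
    ext w
    simp only [mem_filter, mem_map, mem_Iio]
    constructor
    · rintro ⟨hw, hlt⟩
      have : w ∈ Set.range (A.orderEmbOfFin hc) := by rw [range_orderEmbOfFin]; exact hw
      obtain ⟨j, rfl⟩ := this
      exact ⟨j, (OrderEmbedding.lt_iff_lt _).1 hlt, rfl⟩
    · rintro ⟨j, hj, rfl⟩
      exact ⟨orderEmbOfFin_mem _ _ _, (OrderEmbedding.lt_iff_lt _).2 hj⟩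
  rw [this, card_map, Fin.card_Iio]

lemma sl_compD (h : SLSet n s H v) :
    (H.filter (· ⊆ slW v)).card ≤ (H.filter (· ⊆ Icc 1 (3 * s))).card := by
  have h3s : 3 * s ≤ n := by
    have := card_le_card h.Wsub
    rw [h.cardW] at this; simpa using this
  refine sl_compress h.hS (Icc 1 (3 * s)) (slW v) (Icc_subset_Icc le_rfl h3s) (3 * s) (by simp) h.cardW ?_
  intro i
  set x := (Icc 1 (3 * s)).orderEmbOfFin (by simp) i with hx
  set y := (slW v).orderEmbOfFin h.cardW i with hy
  have r1 := sl_rank (Icc 1 (3 * s)) (N := 3 * s) (by simp) i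
  have r2 := sl_rank (slW v) h.cardW i
  rw [← hx] at r1
  rw [← hy] at r2
  have hxm : x ∈ Icc 1 (3 * s) := orderEmbOfFin_mem _ _ _
  have hym : y ∈ slW v := orderEmbOfFin_mem _ _ _
  have hy1 := mem_Icc.1 (h.Wsub hym)
  rw [mem_Icc] at hxm
  have e1 : (Icc 1 (3 * s)).filter (· < x) = Icc 1 (x - 1) := by
    ext w; simp only [mem_filter, mem_Icc]; omega
  rw [e1, Nat.card_Icc] at r1
  have e2 : (slW v).filter (· < y) ⊆ Icc 1 (y - 1) := by
    intro w hw
    rw [mem_filter] at hw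
    have := mem_Icc.1 (h.Wsub hw.1)
    rw [mem_Icc]; omega
  have := card_le_card e2
  rw [r2, Nat.card_Icc] at this
  omega

lemma sl_compS (h : SLSet n s H v) :
    (H.filter (· ⊆ Icc (s + 1) n)).card ≤ (H.filter (· ⊆ Icc 1 n \ univ.image (fun a => v a 0))).card := by
  set I : Finset ℕ := univ.image (fun a => v a 0) with hI
  have hIc : I.card = s := by
    rw [hI, card_image_of_injective]
    · simp
    · intro a b hab; exact h.inj _ _ _ _ hab
  have hIs : I ⊆ Icc 1 n := by
    intro w hw
    obtain ⟨a, _, rfl⟩ := mem_image.1 hw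
    exact mem_Icc.2 (h.pos a 0)
  have hsn : s ≤ n := by
    have := card_le_card hIs
    rw [hIc] at this; simpa using this
  have hA : (Icc 1 n \ I).card = n - s := by rw [card_sdiff_of_subset hIs, hIc]; simp
  have hBc : (Icc (s + 1) n).card = n - s := by simp
  refine sl_compress h.hS (Icc 1 n \ I) (Icc (s + 1) n) sdiff_subset (n - s) hA hBc ?_
  intro i
  set x := (Icc 1 n \ I).orderEmbOfFin hA i with hx
  set y := (Icc (s + 1) n).orderEmbOfFin hBc i with hy
  have r1 := sl_rank (Icc 1 n \ I) hA i
  have r2 := sl_rank (Icc (s + 1) n) hBc i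
  rw [← hx] at r1
  rw [← hy] at r2
  have hxm : x ∈ Icc 1 n \ I := orderEmbOfFin_mem _ _ _
  have hym : y ∈ Icc (s + 1) n := orderEmbOfFin_mem _ _ _
  rw [mem_sdiff, mem_Icc] at hxm
  rw [mem_Icc] at hym
  have e1 : Icc 1 (x - 1) \ I ⊆ (Icc 1 n \ I).filter (· < x) := by
    intro w hw
    simp only [mem_sdiff, mem_filter, mem_Icc] at hw ⊢
    exact ⟨⟨by omega, hw.2⟩, by omega⟩
  have c1 := card_le_card e1
  have c2 := le_card_sdiff I (Icc 1 (x - 1))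
  rw [r1] at c1
  rw [hIc, Nat.card_Icc] at c2
  have e2 : (Icc (s + 1) n).filter (· < y) = Icc (s + 1) (y - 1) := by
    ext w; simp only [mem_filter, mem_Icc]; omega
  rw [e2, Nat.card_Icc] at r2
  omega

end


section
variable {n s : ℕ} {H : Finset (Finset ℕ)} {v : Fin s → Fin 3 → ℕ}

lemma sl_countR (h : SLSet n s H v) (h3s : 3 * s ≤ n) (B : Finset (Fin s)) (hB : B.card ≤ 6)
    (H' : Finset (Finset ℕ))
    (hH' : H' ⊆ H) (U : Finset (Fin 3)) (hU : ∀ e ∈ H', ∀ a x, v a x ∈ e → x ∈ U) (ι : ℕ)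
    (hι : ι = 1 ∨ ∀ e ∈ H', ¬ e ⊆ slW v) :
    6 * (H'.card : ℝ) ≤ ι * (∑ a ∈ Bᶜ, ∑ b ∈ Bᶜ, ∑ c ∈ Bᶜ, (slT3 H v U a b c : ℝ))
      + 3 * ((n : ℝ) - 3 * s) * (∑ a ∈ Bᶜ, ∑ b ∈ Bᶜ, (slP2 H v U a b : ℝ))
      + 3 * ((n : ℝ) - 3 * s) ^ 2 * (∑ a ∈ Bᶜ, (slQ1 H v U a : ℝ)) + 324 * (n : ℝ) ^ 2 := by
  have hc := sl_count h B hB H' hH' U hU ι hι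
  rw [sl_sum_p3 Bᶜ U (fun p q r => slx H v {p, q, r}), sl_sum_p2 Bᶜ U (fun p q => slx H v {p, q}),
    sum_product] at hc
  have hc2 : ((6 * H'.card : ℕ) : ℝ) ≤ ((ι * (∑ a ∈ Bᶜ, ∑ b ∈ Bᶜ, ∑ c ∈ Bᶜ, slT3 H v U a b c)
      + 3 * (n - 3 * s) * (∑ a ∈ Bᶜ, ∑ b ∈ Bᶜ, slP2 H v U a b)
      + 3 * (n - 3 * s) ^ 2 * (∑ a ∈ Bᶜ, slQ1 H v U a) + 324 * n ^ 2 : ℕ) : ℝ) := Nat.cast_le.2 hc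
  push_cast [Nat.cast_sub h3s] at hc2
  exact hc2

lemma sl_ch2 (x : ℕ) : 2 * x.choose 2 + x = x ^ 2 := by
  induction x with
  | zero => rfl
  | succ k ih =>
    have : (k + 1).choose 2 = k.choose 1 + k.choose 2 := rfl
    rw [this, Nat.choose_one_right]; nlinarith

lemma sl_ch3 (x : ℕ) : 6 * x.choose 3 + 3 * x ^ 2 = x ^ 3 + 2 * x := by
  induction x with
  | zero => rfl
  | succ k ih =>
    have : (k + 1).choose 3 = k.choose 2 + k.choose 3 := rfl
    have h2 := sl_ch2 k
    rw [this]; nlinarith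

lemma sl_ch3R (x : ℕ) : 6 * (x.choose 3 : ℝ) + 3 * (x : ℝ) ^ 2 = (x : ℝ) ^ 3 + 2 * x := by
  exact_mod_cast sl_ch3 x

lemma sl_fD {n m g : ℕ} (hg : g + 1 ≤ m) : 27 * (g : ℝ) ^ 3 ≤ 6 * (fEMC n m 3 : ℝ) := by
  have h1 : (3 * m - 1).choose 3 ≤ fEMC n m 3 := le_max_right _ _
  have h2 : (3 * g + 2).choose 3 ≤ (3 * m - 1).choose 3 := Nat.choose_le_choose 3 (by omega)
  have h3 : ((3 * g + 2).choose 3 : ℝ) ≤ fEMC n m 3 := by exact_mod_cast h2.trans h1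
  have h4 := sl_ch3R (3 * g + 2)
  push_cast at h4
  have hg0 : (0 : ℝ) ≤ g := Nat.cast_nonneg g
  nlinarith [sq_nonneg (g : ℝ)]

lemma sl_fS {n m g : ℕ} {r : ℝ} (hr : 0 ≤ r) (hg : g + 1 ≤ m) (hm : 3 * m ≤ n) (hn : 3 * (g : ℝ) + r ≤ n) :
    (g : ℝ) * (19 * (g : ℝ) ^ 2 + 15 * ((g : ℝ) * r) + 3 * r ^ 2) - 3 * (n : ℝ) ^ 2 ≤ 6 * (fEMC n m 3 : ℝ) := by
  have h1 : n.choose 3 - (n - m + 1).choose 3 ≤ fEMC n m 3 := le_max_left _ _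
  have h2 : (n - m + 1).choose 3 ≤ (n - g).choose 3 := Nat.choose_le_choose 3 (by omega)
  have h3 : n.choose 3 ≤ fEMC n m 3 + (n - g).choose 3 := by omega
  have h3' : (n.choose 3 : ℝ) ≤ fEMC n m 3 + (n - g).choose 3 := by exact_mod_cast h3
  have h4 := sl_ch3R n
  have h5 := sl_ch3R (n - g)
  rw [Nat.cast_sub (by omega)] at h5
  have hg0 : (0 : ℝ) ≤ g := Nat.cast_nonneg g
  have hgn : (g : ℝ) ≤ n := by exact_mod_cast (by omega : g ≤ n)
  obtain ⟨d, hd⟩ : ∃ d : ℝ, (n : ℝ) = 3 * g + r + d := ⟨n - (3 * g + r), by ring⟩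
  have hd0 : 0 ≤ d := by linarith
  have key : (g : ℝ) * (19 * (g : ℝ) ^ 2 + 15 * ((g : ℝ) * r) + 3 * r ^ 2) ≤ (n : ℝ) ^ 3 - (n - g) ^ 3 := by
    have : (n : ℝ) ^ 3 - (n - g) ^ 3 - (g : ℝ) * (19 * (g : ℝ) ^ 2 + 15 * ((g : ℝ) * r) + 3 * r ^ 2)
       = 3 * g * d ^ 2 + 6 * g * r * d + 15 * g ^ 2 * d := by rw [hd]; ring
    have : 0 ≤ 3 * g * d ^ 2 + 6 * g * r * d + 15 * g ^ 2 * d := by positivity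
    linarith
  nlinarith [sq_nonneg ((n : ℝ) - g)]

lemma sl_fin1 {n g r c F δ h X f : ℝ} (hg : 0 < g) (hr : 0 ≤ r) (hn : 3600 ≤ n) (hc : 0 ≤ c)
    (h1 : n - 18 ≤ 3 * g + r) (h2 : 3 * g + r ≤ n)
    (hX : 6 * h ≤ X + 324 * n ^ 2)
    (hL : g ^ 2 * X ≤ g ^ 3 * F - 0.019 * (3 * g + r) ^ 2 * c + 30 * (3 * g + r) ^ 2 * g ^ 2)
    (hh : h > f - δ * n ^ 3) (hf : g * F - 3 * n ^ 2 ≤ 6 * f) :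
    n ^ 2 * c ≤ g ^ 2 * ((357 * n ^ 2 + 6 * δ * n ^ 3) / 0.01881) := by
  set N := 3 * g + r with hN
  have hN1 : 0.99 * n ^ 2 ≤ N ^ 2 := by nlinarith
  have hN2 : N ^ 2 ≤ n ^ 2 := by nlinarith
  have e1 : g * F - 3 * n ^ 2 - 6 * δ * n ^ 3 - 324 * n ^ 2 ≤ X := by linarith
  have e2 := mul_le_mul_of_nonneg_left e1 (sq_nonneg g)
  have e3 := mul_le_mul_of_nonneg_right hN1 hc
  have e4 := mul_le_mul_of_nonneg_right hN2 (sq_nonneg g)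
  have e5 : 0.01881 * (n ^ 2 * c) ≤ g ^ 2 * (357 * n ^ 2 + 6 * δ * n ^ 3) := by nlinarith
  rw [← mul_div_assoc, le_div_iff₀ (by norm_num)]
  linarith

lemma sl_fin2 {n g r c δ h Y κ Z : ℝ} (hg : 0 < g) (hr : 0 ≤ r) (hn : 3600 ≤ n) (hc : 0 ≤ c) (hδ : 0 ≤ δ)
    (h2 : 3 * g + r ≤ n)
    (hC : n ^ 2 * c ≤ g ^ 2 * ((357 * n ^ 2 + 6 * δ * n ^ 3) / 0.01881))
    (hY : 6 * h ≤ Y + 324 * n ^ 2)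
    (hL : g ^ 2 * Y ≤ (3 * g + r) ^ 2 * Z + 30 * (3 * g + r) ^ 2 * g ^ 2)
    (hZ : Z ≤ 3.5 * c) :
    h ≤ 187 * δ * n ^ 3 + 12000 * n ^ 2 := by
  set N := 3 * g + r with hN
  have hN2 : N ^ 2 ≤ n ^ 2 := by nlinarith
  have e3 := mul_le_mul_of_nonneg_left hZ (sq_nonneg N)
  have e4 := mul_le_mul_of_nonneg_right hN2 hc
  have e5 := mul_le_mul_of_nonneg_right hN2 (sq_nonneg g)
  have e6 := mul_le_mul_of_nonneg_left hY (sq_nonneg g)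
  have e7 : g ^ 2 * (6 * h) ≤ g ^ 2 * (3.5 * ((357 * n ^ 2 + 6 * δ * n ^ 3) / 0.01881) + 354 * n ^ 2) := by
    nlinarith
  have e8 := le_of_mul_le_mul_left e7 (by positivity)
  have p1 : 0 ≤ δ * n ^ 3 := by positivity
  have p2 : 0 ≤ n ^ 2 := by positivity
  have e9 : 3.5 * ((357 * n ^ 2 + 6 * δ * n ^ 3) / 0.01881) ≤ 187 * (357 * n ^ 2 + 6 * δ * n ^ 3) := by
    have : 3.5 * ((357 * n ^ 2 + 6 * δ * n ^ 3) / 0.01881) = (3.5 / 0.01881) * (357 * n ^ 2 + 6 * δ * n ^ 3) := by ring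
    rw [this]
    apply mul_le_mul_of_nonneg_right (by norm_num)
    nlinarith
  nlinarith

lemma sl_core {m : ℕ} {δ : ℝ} (hδ : 0 ≤ δ) (h : SLSet n s H v) (hs : s + 1 ≤ m) (hm : 3 * m ≤ n) (hn : 3600 ≤ n)
    (hH : (H.card : ℝ) > (fEMC n m 3 : ℝ) - δ * (n : ℝ) ^ 3) :
    ((H.filter (· ⊆ Icc 1 n \ univ.image (fun a => v a 0))).card : ℝ) ≤ 187 * δ * (n : ℝ) ^ 3 + 12000 * (n : ℝ) ^ 2 ∨
    ((H.filter (fun e => ¬ e ⊆ slW v)).card : ℝ) ≤ 187 * δ * (n : ℝ) ^ 3 + 12000 * (n : ℝ) ^ 2 := by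
  obtain ⟨B, hB6, hB⟩ := sl_exists_B h
  have hA := sl_inst h B hB
  have h3s : 3 * s ≤ n := by omega
  have hnR : (3600 : ℝ) ≤ n := by exact_mod_cast hn
  have hr : (0 : ℝ) ≤ (n : ℝ) - 3 * s := by
    have : ((3 * s : ℕ) : ℝ) ≤ n := Nat.cast_le.2 h3s
    push_cast at this; linarith
  have C1 := sl_countR h h3s B hB6 H (Subset.refl _) univ (fun _ _ _ _ _ => mem_univ _) 1 (Or.inl rfl)
  have C2 := sl_countR h h3s B hB6 (H.filter (fun e => ¬ e ⊆ slW v)) (filter_subset _ _) univ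
    (fun _ _ _ _ _ => mem_univ _) 0 (Or.inr (fun e he => (mem_filter.1 he).2))
  have C3 := sl_countR h h3s B hB6 (H.filter (· ⊆ Icc 1 n \ univ.image (fun a => v a 0))) (filter_subset _ _) {1, 2}
    (by
      intro e he a x hx
      have h1 := mem_sdiff.1 ((mem_filter.1 he).2 hx)
      have hx0 : x ≠ 0 := by
        rintro rfl
        exact h1.2 (mem_image.2 ⟨a, mem_univ _, rfl⟩)
      revert hx0; clear h1 hx
      revert x; decide) 1 (Or.inl rfl)
  have L1 := sl_L1 hA hr (le_max_left _ _) (le_max_right _ _)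
  have L2 := sl_L2 hA hr
  have L3 := sl_L3 hA hr
  have L4 := sl_L4 hA
  have hBc : (Bᶜ).card = s - B.card := by rw [card_compl, Fintype.card_fin]
  have hBs : B.card ≤ s := by simpa using card_le_univ B
  have hg1 : (Bᶜ).card ≤ s := by omega
  have hg2 : s ≤ (Bᶜ).card + 6 := by omega
  have fD := sl_fD (n := n) (m := m) (g := (Bᶜ).card) (by omega)
  have hg1R : ((Bᶜ).card : ℝ) ≤ s := by exact_mod_cast hg1
  have hg2R : (s : ℝ) ≤ ((Bᶜ).card : ℝ) + 6 := by exact_mod_cast hg2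
  have fS := sl_fS (n := n) (m := m) (g := (Bᶜ).card) hr (by omega) hm (by linarith)
  have kk0 : (0 : ℝ) ≤ ∑ a ∈ Bᶜ, ((slx H v {(a, 0)} : ℕ) : ℝ) := sum_nonneg (fun _ _ => Nat.cast_nonneg _)
  have kk1 : ∑ a ∈ Bᶜ, ((slx H v {(a, 0)} : ℕ) : ℝ) ≤ ((Bᶜ).card : ℝ) := by
    have := sum_le_card_nsmul Bᶜ (fun a => ((slx H v {(a, 0)} : ℕ) : ℝ)) 1 (fun a _ => by exact_mod_cast slx_le _)
    simpa using this
  have p2 : 0 ≤ (n : ℝ) ^ 2 := by positivity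
  have p3 : 0 ≤ 187 * δ * (n : ℝ) ^ 3 := by positivity
  rcases Nat.eq_zero_or_pos (Bᶜ).card with h0 | hpos
  · right
    rw [card_eq_zero.1 h0] at C2
    simp only [sum_empty, mul_zero, zero_add] at C2
    linarith
  have hpos : (0 : ℝ) < ((Bᶜ).card : ℝ) := by exact_mod_cast hpos
  have q1 : (n : ℝ) - 18 ≤ 3 * ((Bᶜ).card : ℝ) + ((n : ℝ) - 3 * s) := by linarith
  have q2 : 3 * ((Bᶜ).card : ℝ) + ((n : ℝ) - 3 * s) ≤ n := by linarith
  generalize slcO Bᶜ (slP2 H v univ) (fun a => slx H v {(a, 0)}) = c at *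
  generalize (∑ a ∈ Bᶜ, ((slx H v {(a, 0)} : ℕ) : ℝ)) = k at *
  generalize ((Bᶜ).card : ℝ) = g at *
  generalize (n : ℝ) - 3 * s = r at *
  have hc : 0 ≤ c := by
    have : 0 ≤ 3 * g * k * (g - k) := mul_nonneg (by positivity) (by linarith)
    linarith
  have hC := sl_fin1 (F := max (27 * g ^ 2) (19 * g ^ 2 + 15 * (g * r) + 3 * r ^ 2))
    (f := (fEMC n m 3 : ℝ)) (h := (H.card : ℝ)) (δ := δ) hpos hr hnR hc q1 q2 C1 (by
      push_cast; rw [one_mul]; exact L1) hH (by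
      rcases max_choice (27 * g ^ 2) (19 * g ^ 2 + 15 * (g * r) + 3 * r ^ 2) with e | e <;> rw [e]
      · nlinarith
      · exact fS)
  rcases le_total (g / 2) k with hk | hk
  · left
    refine sl_fin2 (κ := 0) (Z := 9 / 7 * (g ^ 3 - k ^ 3)) hpos hr hnR hc hδ q2 hC C3 ?_ ?_
    · push_cast; rw [one_mul]; refine L3.trans (le_of_eq ?_); ring
    · have : g ^ 3 - k ^ 3 ≤ 7 / 6 * (3 * g * k * (g - k)) := by
        have e : 7 / 6 * (3 * g * k * (g - k)) - (g ^ 3 - k ^ 3) = (g - k) * ((k - g / 2) * (2 * g - k)) := by ring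
        have : 0 ≤ (g - k) * ((k - g / 2) * (2 * g - k)) :=
          mul_nonneg (by linarith) (mul_nonneg (by linarith) (by linarith))
        linarith
      linarith
  · right
    refine sl_fin2 (κ := 0) (Z := 3 * (c + k ^ 3)) hpos hr hnR hc hδ q2 hC C2 ?_ ?_
    · push_cast; rw [zero_mul, zero_add]; refine L2.trans (le_of_eq ?_); ring
    · have : k ^ 3 ≤ 1 / 6 * (3 * g * k * (g - k)) := by
        have e : 1 / 6 * (3 * g * k * (g - k)) - k ^ 3 = k * ((g / 2 - k) * (g + k)) := by ring
        have : 0 ≤ k * ((g / 2 - k) * (g + k)) :=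
          mul_nonneg (by linarith) (mul_nonneg (by linarith) (by linarith))
        linarith
      linarith

lemma sl_cardS {n m : ℕ} (hm1 : 1 ≤ m) (hm : 3 * m ≤ n) : (SGraph n m 3).card ≤ n.choose 3 - (n - m + 1).choose 3 := by
  have hsub : SGraph n m 3 ⊆ (Icc 1 n).powersetCard 3 \ (Icc m n).powersetCard 3 := by
    intro e he
    obtain ⟨h1, x, hx⟩ := mem_filter.1 he
    refine mem_sdiff.2 ⟨h1, fun h2 => ?_⟩
    have h3 := mem_Icc.1 ((mem_powersetCard.1 h2).1 (mem_inter.1 hx).1)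
    have h4 := mem_Icc.1 (mem_inter.1 hx).2
    omega
  refine (card_le_card hsub).trans ?_
  rw [card_sdiff_of_subset (powersetCard_mono (Icc_subset_Icc hm1 le_rfl)), card_powersetCard, card_powersetCard,
    Nat.card_Icc, Nat.card_Icc]
  have : n + 1 - m = n - m + 1 := by omega
  rw [this]; simp

theorem stability_lemma_aux (ε : ℝ) (hε : 0 < ε) :
    ∃ n₁ : ℕ, 0 < n₁ ∧ ∀ n : ℕ, n ≥ n₁ → ∀ m : ℕ, 1 ≤ m → 3 * m ≤ n →
      ∀ H : Finset (Finset ℕ), IsKGraphOn n 3 H → StableGraph n H →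
        (H.card : ℝ) > (fEMC n m 3 : ℝ) - ε ^ 4 * (n : ℝ) ^ 3 →
        (∀ M ⊆ H, IsMatching M → M.card < m) →
        IsEpsClose ε n 3 (SGraph n m 3) H ∨ IsEpsClose ε n 3 (DGraph n m 3) H := by
  rcases le_total (1 / 6) ε with hbig | hsmall
  · refine ⟨1, one_pos, fun n hn m hm1 hm H hK hS hH hM => Or.inl ?_⟩
    unfold IsEpsClose
    have h1 : (SGraph n m 3 \ H).card ≤ n.choose 3 :=
      (card_le_card sdiff_subset).trans ((sl_cardS hm1 hm).trans (Nat.sub_le _ _))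
    have h1R : ((SGraph n m 3 \ H).card : ℝ) ≤ n.choose 3 := by exact_mod_cast h1
    have h2 := sl_ch3R n
    have hn1 : (1 : ℝ) ≤ n := by exact_mod_cast hn
    have h3 : 1 / 6 * (n : ℝ) ^ 3 ≤ ε * (n : ℝ) ^ 3 := mul_le_mul_of_nonneg_right hbig (by positivity)
    nlinarith
  · obtain ⟨N, hN⟩ := exists_nat_gt (429 / ε ^ 4)
    refine ⟨N + 3600, by omega, fun n hn m hm1 hm H hK hS hH hM => ?_⟩
    obtain ⟨s, v, h, hs⟩ := sl_exists hK hS hM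
    have hδ : 0 < ε ^ 4 := by positivity
    have core := sl_core hδ.le h hs hm (by omega) hH
    have hnN : (N : ℝ) ≤ n := by exact_mod_cast (by omega : N ≤ n)
    have hn0 : (0 : ℝ) ≤ n := Nat.cast_nonneg n
    have b1 : 429 ≤ ε ^ 4 * n := by
      have := (div_lt_iff₀ hδ).1 hN
      nlinarith
    have b2 : 12000 * (n : ℝ) ^ 2 ≤ 28 * ε ^ 4 * (n : ℝ) ^ 3 := by
      have : 0 ≤ (n : ℝ) ^ 2 * (28 * (ε ^ 4 * n - 429)) := by
        apply mul_nonneg (by positivity); linarith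
      nlinarith [sq_nonneg (n : ℝ)]
    have b3 : 216 * ε ^ 4 ≤ ε := by
      have : ε ^ 3 ≤ (1 / 6) ^ 3 := pow_le_pow_left₀ hε.le hsmall 3
      have : ε ^ 3 * ε ≤ (1 / 6) ^ 3 * ε := mul_le_mul_of_nonneg_right this hε.le
      nlinarith
    have b4 : 216 * ε ^ 4 * (n : ℝ) ^ 3 ≤ ε * (n : ℝ) ^ 3 := mul_le_mul_of_nonneg_right b3 (by positivity)
    rcases core with hc | hc
    · left
      unfold IsEpsClose
      have c1 : (SGraph n m 3 \ H).card + (SGraph n m 3 ∩ H).card = (SGraph n m 3).card :=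
        card_sdiff_add_card_inter _ _
      have c2 : (SGraph n m 3).card ≤ fEMC n m 3 := (sl_cardS hm1 hm).trans (le_max_left _ _)
      have c3 : H ⊆ (SGraph n m 3 ∩ H) ∪ H.filter (· ⊆ Icc (s + 1) n) := by
        intro e he
        by_cases hS : e ∈ SGraph n m 3
        · exact mem_union_left _ (mem_inter.2 ⟨hS, he⟩)
        · refine mem_union_right _ (mem_filter.2 ⟨he, fun x hx => ?_⟩)
          have hx1 := mem_Icc.1 ((hK e he).1 hx)
          refine mem_Icc.2 ⟨?_, hx1.2⟩
          by_contra hlt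
          apply hS
          refine mem_filter.2 ⟨mem_powersetCard.2 (hK e he), x, mem_inter.2 ⟨hx, mem_Icc.2 ⟨hx1.1, ?_⟩⟩⟩
          omega
      have c4 := (card_le_card c3).trans (card_union_le _ _)
      have c5 := sl_compS h
      have c6 : (SGraph n m 3 \ H).card + H.card ≤ fEMC n m 3 +
        (H.filter (· ⊆ Icc 1 n \ univ.image (fun a => v a 0))).card := by omega
      have c6R : ((SGraph n m 3 \ H).card : ℝ) + H.card ≤ fEMC n m 3 +
        (H.filter (· ⊆ Icc 1 n \ univ.image (fun a => v a 0))).card := by exact_mod_cast c6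
      linarith
    · right
      unfold IsEpsClose
      have c1 : (DGraph n m 3 \ H).card + (DGraph n m 3 ∩ H).card = (DGraph n m 3).card :=
        card_sdiff_add_card_inter _ _
      have c2 : (DGraph n m 3).card ≤ fEMC n m 3 := by
        unfold DGraph; rw [card_powersetCard, Nat.card_Icc]
        exact le_max_right (n.choose 3 - (n - m + 1).choose 3) ((3 * m - 1).choose 3)
      have c3 : H.filter (· ⊆ Icc 1 (3 * s)) ⊆ DGraph n m 3 ∩ H := by
        intro e he
        obtain ⟨he, h2⟩ := mem_filter.1 he
        exact mem_inter.2 ⟨mem_powersetCard.2 ⟨h2.trans (Icc_subset_Icc le_rfl (by omega)), (hK e he).2⟩, he⟩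
      have c4 := card_le_card c3
      have c5 := sl_compD h
      have c7 := card_filter_add_card_filter_not (s := H) (fun e => e ⊆ slW v)
      have c6 : (DGraph n m 3 \ H).card + H.card ≤ fEMC n m 3 +
        (H.filter (fun e => ¬ e ⊆ slW v)).card := by omega
      have c6R : ((DGraph n m 3 \ H).card : ℝ) + H.card ≤ fEMC n m 3 +
        (H.filter (fun e => ¬ e ⊆ slW v)).card := by exact_mod_cast c6
      linarith

end

/-- stability — a stable 3-graph with no matching of size `m` and
almost extremal size is `ε`-close to `S(n,m,3)` or `D(n,m,3)`. -/
theorem stability_lemma (ε : ℝ) (hε : 0 < ε) :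
    ∃ n₁ : ℕ, 0 < n₁ ∧ ∀ n : ℕ, n ≥ n₁ → ∀ m : ℕ, 1 ≤ m → 3 * m ≤ n →
      ∀ H : Finset (Finset ℕ), IsKGraphOn n 3 H → StableGraph n H →
        (H.card : ℝ) > (fEMC n m 3 : ℝ) - ε ^ 4 * (n : ℝ) ^ 3 →
        (∀ M ⊆ H, IsMatching M → M.card < m) →
        IsEpsClose ε n 3 (SGraph n m 3) H ∨ IsEpsClose ε n 3 (DGraph n m 3) H := by
  exact stability_lemma_aux ε hε
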